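/- Let (a_n : n ∈ ℕ₀) ⊆ (0,∞) be a lacunary sequence, i.e. a := inf_{n∈ℕ₀} a_{n+1}/a_n > 1. Then for every p ∈ (1, ∞] there exists a constant C_p > 0, depending only on p and on a (in particular independent of the dimension d), such that for every d ∈ ℕ and every f ∈ ℓ^p(ℤ^d) one has ‖ sup_{n∈ℕ₀} |𝓜_{a_n} f| ‖_{ℓ^p(ℤ^d)} ≤ C_p ‖f‖_{ℓ^p(ℤ^d)}. -/

import Mathlib

open MeasureTheory ENNReal

/-- The ℓ^p(ℤ^d) "norm" of a nonnegative (ℝ≥0∞-valued) function, `p ∈ (0,∞]`. -/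
noncomputable def lpZ (d : ℕ) (p : ℝ≥0∞) (g : (Fin d → ℤ) → ℝ≥0∞) : ℝ≥0∞ :=
  if p = ∞ then ⨆ x, g x else (∑' x, g x ^ p.toReal) ^ (1 / p.toReal)

/-- `x ↦ ‖f x‖₊` as an ℝ≥0∞-valued function. -/
noncomputable def nnC {d : ℕ} (f : (Fin d → ℤ) → ℂ) : (Fin d → ℤ) → ℝ≥0∞ :=
  fun x => (‖f x‖₊ : ℝ≥0∞)

/-- The discrete Hardy–Littlewood averaging operator over the cube `Q_t = [-t,t]^d`. -/
noncomputable def cubeAvg (d : ℕ) (t : ℝ) (f : (Fin d → ℤ) → ℂ) (x : Fin d → ℤ) : ℂ :=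
  (((2 * ⌊t⌋ + 1) ^ d : ℤ) : ℂ)⁻¹ *
    ∑ y ∈ Finset.Icc (fun _ => -⌊t⌋ : Fin d → ℤ) (fun _ => ⌊t⌋), f (x - y)

set_option linter.unusedSectionVars false


lemma doob_num {p a b : ℝ} (hp : 1 < p) (ha : 0 ≤ a) (hb : 0 ≤ b) :
    b ^ p - a ^ p ≤ p / (p - 1) * ((b ^ (p - 1) - a ^ (p - 1)) * b) := by
  have hq : 0 < p - 1 := by linarith
  have hc : p.HolderConjugate (p / (p - 1)) := by
    rw [Real.holderConjugate_iff]; refine ⟨hp, ?_⟩; field_simp; ring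
  have hy := Real.young_inequality_of_nonneg hb (Real.rpow_nonneg ha (p - 1)) hc
  have e1 : (a ^ (p - 1)) ^ (p / (p - 1)) = a ^ p := by
    rw [← Real.rpow_mul ha]; congr 1; field_simp
  have e2 : b ^ (p - 1) * b = b ^ p := by
    nth_rewrite 2 [← Real.rpow_one b]
    rw [← Real.rpow_add_of_nonneg hb hq.le zero_le_one]; congr 1; ring
  rw [e1] at hy
  rw [sub_mul, e2]
  have : p / (p - 1) * (b ^ p - a ^ (p - 1) * b) - (b ^ p - a ^ p)
    = p / (p - 1) * (b ^ p / p + a ^ p / (p / (p - 1)) - b * a ^ (p - 1)) := by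
    field_simp; ring
  have h3 : 0 ≤ p / (p - 1) * (b ^ p / p + a ^ p / (p / (p - 1)) - b * a ^ (p - 1)) := by
    apply mul_nonneg
    · positivity
    · linarith
  linarith

lemma sq_num {p a b M : ℝ} (hp : 1 < p) (hp2 : p < 2) (ha : 0 ≤ a) (hb : 0 ≤ b) (haM : a ≤ M)
    (hbM : b ≤ M) (hM : 0 < M) :
    p * (p - 1) / 2 * (M ^ (p - 2) * (b - a) ^ 2) ≤ b ^ p - a ^ p - p * a ^ (p - 1) * (b - a) := by
  set c := p * (p - 1) * M ^ (p - 2) with hc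
  have hd : ∀ x : ℝ, HasDerivAt (fun x => x ^ p - c / 2 * x ^ 2) (p * x ^ (p - 1) - c * x) x := by
    intro x
    have h1 := Real.hasDerivAt_rpow_const (x := x) (p := p) (Or.inr hp.le)
    have h2 := (hasDerivAt_pow 2 x).const_mul (c / 2)
    exact (h1.sub h2).congr_deriv (by norm_num; ring)
  have hconv : ConvexOn ℝ (Set.Icc 0 M) (fun x => x ^ p - c / 2 * x ^ 2) := by
    apply MonotoneOn.convexOn_of_deriv (convex_Icc 0 M)
    · exact fun x _ => (hd x).continuousAt.continuousWithinAt
    · exact fun x _ => (hd x).differentiableAt.differentiableWithinAt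
    · have : deriv (fun x => x ^ p - c / 2 * x ^ 2) = fun x => p * x ^ (p - 1) - c * x :=
        funext fun x => (hd x).deriv
      rw [this]
      have hd2 : ∀ x ∈ Set.Ioo (0:ℝ) M, HasDerivAt (fun x => p * x ^ (p - 1) - c * x)
          (p * ((p - 1) * x ^ (p - 1 - 1)) - c) x := by
        intro x hx
        have h1 := (Real.hasDerivAt_rpow_const (x := x) (p := p - 1) (Or.inl hx.1.ne')).const_mul p
        have h2 := (hasDerivAt_id x).const_mul c
        exact (h1.sub h2).congr_deriv (by norm_num)
      rw [interior_Icc]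
      apply monotoneOn_of_deriv_nonneg (convex_Ioo 0 M)
      · exact fun x hx => (hd2 x hx).continuousAt.continuousWithinAt
      · rw [interior_Ioo]
        exact fun x hx => (hd2 x hx).differentiableAt.differentiableWithinAt
      · rw [interior_Ioo]
        intro x hx
        rw [(hd2 x hx).deriv, hc]
        have : M ^ (p - 2) ≤ x ^ (p - 1 - 1) := by
          rw [show p - 1 - 1 = p - 2 by ring]
          exact Real.rpow_le_rpow_of_nonpos hx.1 hx.2.le (by linarith)
        have h0 : 0 ≤ p * (p - 1) := mul_nonneg (by linarith) (by linarith)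
        nlinarith [mul_le_mul_of_nonneg_left this h0]
  have key : (p * a ^ (p - 1) - c * a) * (b - a) ≤
      (b ^ p - c / 2 * b ^ 2) - (a ^ p - c / 2 * a ^ 2) := by
    rcases lt_trichotomy a b with h | h | h
    · have := hconv.le_slope_of_hasDerivAt ⟨ha, haM⟩ ⟨hb, hbM⟩ h (hd a)
      rw [slope_def_field, le_div_iff₀ (by linarith)] at this
      exact this
    · subst h; simp
    · have := hconv.slope_le_of_hasDerivAt ⟨hb, hbM⟩ ⟨ha, haM⟩ h (hd a)
      rw [slope_def_field, div_le_iff₀ (by linarith)] at this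
      linarith
  have : p * (p - 1) / 2 * (M ^ (p - 2) * (b - a) ^ 2) = c / 2 * (b - a) ^ 2 := by rw [hc]; ring
  rw [this]
  nlinarith

section mart
variable {Ω : Type*} [Fintype Ω]

def runMax (f : ℕ → Ω → ℝ) : ℕ → Ω → ℝ
  | 0 => f 0
  | n + 1 => fun ω => max (runMax f n ω) (f (n + 1) ω)

lemma le_runMax (f : ℕ → Ω → ℝ) (n m : ℕ) (h : m ≤ n) (ω : Ω) : f m ω ≤ runMax f n ω := by
  induction n with
  | zero => simp at h; subst h; exact le_rfl
  | succ n ih =>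
    rcases Nat.lt_or_ge n m with h1 | h1
    · have : m = n + 1 := by omega
      subst this; exact le_max_right _ _
    · exact (ih h1).trans (le_max_left _ _)

variable (R : ℕ → Ω → Ω → Prop) (f : ℕ → Ω → ℝ)

lemma runMax_meas (hR : ∀ n ω ω', R (n + 1) ω ω' → R n ω ω')
    (hm : ∀ n ω ω', R n ω ω' → f n ω = f n ω') (n : ℕ) :
    ∀ ω ω', R n ω ω' → runMax f n ω = runMax f n ω' := by
  induction n with
  | zero => exact hm 0
  | succ n ih =>
    intro ω ω' h
    simp only [runMax]
    rw [ih _ _ (hR _ _ _ h), hm _ _ _ h]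

theorem doob {p : ℝ} (hp : 1 < p) (hR : ∀ n ω ω', R (n + 1) ω ω' → R n ω ω')
    (hm : ∀ n ω ω', R n ω ω' → f n ω = f n ω') (h0 : ∀ n ω, 0 ≤ f n ω)
    (hmart : ∀ n (h : Ω → ℝ), (∀ ω ω', R n ω ω' → h ω = h ω') →
      ∑ ω, h ω * (f (n + 1) ω - f n ω) = 0) (J : ℕ) :
    ∑ ω, runMax f J ω ^ p ≤ (p / (p - 1)) ^ p * ∑ ω, f J ω ^ p := by
  have hM0 : ∀ n ω, 0 ≤ runMax f n ω := fun n ω => (h0 0 ω).trans (le_runMax f n 0 (by omega) ω)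
  have hq : 0 < p - 1 := by linarith
  have hK : 1 ≤ p / (p - 1) := by rw [le_div_iff₀ hq]; linarith
  have key : ∀ n, ∑ ω, runMax f n ω ^ p ≤ p / (p - 1) * ∑ ω, runMax f n ω ^ (p - 1) * f n ω := by
    intro n
    induction n with
    | zero =>
      rw [Finset.mul_sum]
      refine Finset.sum_le_sum fun ω _ => ?_
      simp only [runMax]
      have e2 : f 0 ω ^ (p - 1) * f 0 ω = f 0 ω ^ p := by
        nth_rewrite 2 [← Real.rpow_one (f 0 ω)]
        rw [← Real.rpow_add_of_nonneg (h0 0 ω) hq.le zero_le_one]; congr 1; ring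
      rw [e2]
      exact le_mul_of_one_le_left (Real.rpow_nonneg (h0 0 ω) _) hK
    | succ n ih =>
      have hmm := hmart n (fun ω => runMax f n ω ^ (p - 1)) (fun ω ω' h => by
        simp only [runMax_meas R f hR hm n ω ω' h])
      have h1 : ∑ ω, runMax f n ω ^ (p - 1) * f n ω = ∑ ω, runMax f n ω ^ (p - 1) * f (n + 1) ω := by
        simp only [mul_sub, Finset.sum_sub_distrib] at hmm
        linarith
      rw [h1] at ih
      have h2 : ∑ ω, runMax f (n+1) ω ^ p ≤ ∑ ω, (runMax f n ω ^ p + p / (p - 1) *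
          ((runMax f (n + 1) ω ^ (p - 1) - runMax f n ω ^ (p - 1)) * f (n + 1) ω)) := by
        refine Finset.sum_le_sum fun ω _ => ?_
        have hd := doob_num hp (hM0 n ω) (hM0 (n + 1) ω)
        rcases le_total (f (n + 1) ω) (runMax f n ω) with h | h
        · have : runMax f (n + 1) ω = runMax f n ω := max_eq_left h
          rw [this]; simp
        · have : runMax f (n + 1) ω = f (n + 1) ω := max_eq_right h
          rw [this] at hd ⊢; linarith
      refine h2.trans ?_
      rw [Finset.sum_add_distrib, ← Finset.mul_sum]
      simp only [sub_mul, Finset.sum_sub_distrib, mul_sub]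
      linarith
  have hk := key J
  have hc : (p / (p - 1)).HolderConjugate p := by
    refine Real.HolderConjugate.symm ?_
    rw [Real.holderConjugate_iff]; refine ⟨hp, ?_⟩; field_simp; ring
  have h3 : p / (p - 1) * ∑ ω, runMax f J ω ^ (p - 1) * f J ω ≤
      ∑ ω, ((1 - 1 / p) * runMax f J ω ^ p + (p / (p - 1)) ^ p * f J ω ^ p / p) := by
    rw [Finset.mul_sum]
    refine Finset.sum_le_sum fun ω _ => ?_
    have hy := Real.young_inequality_of_nonneg (Real.rpow_nonneg (hM0 J ω) (p - 1))
      (mul_nonneg (by linarith : 0 ≤ p / (p - 1)) (h0 J ω)) hc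
    have e1 : (runMax f J ω ^ (p - 1)) ^ (p / (p - 1)) = runMax f J ω ^ p := by
      rw [← Real.rpow_mul (hM0 J ω)]; congr 1; field_simp
    rw [e1, Real.mul_rpow (by linarith) (h0 J ω)] at hy
    have e3 : runMax f J ω ^ p / (p / (p - 1)) = (1 - 1 / p) * runMax f J ω ^ p := by
      field_simp
    rw [e3] at hy
    linarith
  rw [Finset.sum_add_distrib, ← Finset.mul_sum] at h3
  have h4 : ∑ ω, (p / (p - 1)) ^ p * f J ω ^ p / p = (p / (p - 1)) ^ p * (∑ ω, f J ω ^ p) / p := by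
    rw [Finset.mul_sum, Finset.sum_div]
  rw [h4] at h3
  have h5 : (∑ ω, runMax f J ω ^ p) / p ≤ (p / (p - 1)) ^ p * (∑ ω, f J ω ^ p) / p := by
    have : (1 - 1 / p) * ∑ ω, runMax f J ω ^ p = ∑ ω, runMax f J ω ^ p - (∑ ω, runMax f J ω ^ p) / p := by
      ring
    linarith
  exact (div_le_div_iff_of_pos_right (by linarith)).1 h5

theorem sqfun {p : ℝ} (hp : 1 < p) (hp2 : p < 2) (hR : ∀ n ω ω', R (n + 1) ω ω' → R n ω ω')
    (hm : ∀ n ω ω', R n ω ω' → f n ω = f n ω') (h0 : ∀ n ω, 0 ≤ f n ω)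
    (hmart : ∀ n (h : Ω → ℝ), (∀ ω ω', R n ω ω' → h ω = h ω') →
      ∑ ω, h ω * (f (n + 1) ω - f n ω) = 0) (J : ℕ) :
    ∑ ω, (f 0 ω ^ 2 + ∑ n ∈ Finset.range J, (f (n + 1) ω - f n ω) ^ 2) ^ (p / 2) ≤
      (2 / (p * (p - 1)) + (p / (p - 1)) ^ p) * ∑ ω, f J ω ^ p := by
  have hM0 : ∀ n ω, 0 ≤ runMax f n ω := fun n ω => (h0 0 ω).trans (le_runMax f n 0 (by omega) ω)
  have hq : 0 < p - 1 := by linarith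
  set c := p * (p - 1) / 2 with hcdef
  have hc0 : 0 < c := by positivity
  have hc1 : c ≤ 1 := by rw [hcdef]; nlinarith
  set S : Ω → ℝ := fun ω => f 0 ω ^ 2 + ∑ n ∈ Finset.range J, (f (n + 1) ω - f n ω) ^ 2 with hS
  have hS0 : ∀ ω, 0 ≤ S ω := fun ω => by positivity
  have h1 : ∀ ω, c * (runMax f J ω ^ (p - 2) * S ω) ≤ f 0 ω ^ p + ∑ n ∈ Finset.range J,
      (f (n + 1) ω ^ p - f n ω ^ p - p * f n ω ^ (p - 1) * (f (n + 1) ω - f n ω)) := by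
    intro ω
    rcases (hM0 J ω).eq_or_lt with hM | hM
    · have hz : ∀ n ≤ J, f n ω = 0 := fun n hn => le_antisymm (hM ▸ le_runMax f J n hn ω) (h0 n ω)
      have hSz : S ω = 0 := by
        simp only [hS]
        rw [hz 0 (by omega), Finset.sum_eq_zero]; · simp
        intro n hn
        rw [Finset.mem_range] at hn
        rw [hz n (by omega), hz (n+1) (by omega)]; simp
      rw [hSz, Finset.sum_eq_zero, hz 0 (by omega)]
      · simp; exact Real.rpow_nonneg le_rfl _
      · intro n hn
        rw [Finset.mem_range] at hn
        rw [hz n (by omega), hz (n+1) (by omega)]; simp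
    · have a1 : c * (runMax f J ω ^ (p - 2) * f 0 ω ^ 2) ≤ f 0 ω ^ p := by
        have hle := le_runMax f J 0 (by omega) ω
        have := sq_num hp hp2 le_rfl (h0 0 ω) hM.le hle hM
        rw [Real.zero_rpow (by linarith), Real.zero_rpow (by linarith)] at this
        simpa using this
      have a2 : ∀ n ∈ Finset.range J, c * (runMax f J ω ^ (p - 2) * (f (n + 1) ω - f n ω) ^ 2) ≤
          (f (n + 1) ω ^ p - f n ω ^ p - p * f n ω ^ (p - 1) * (f (n + 1) ω - f n ω)) := by
        intro n hn
        rw [Finset.mem_range] at hn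
        exact sq_num hp hp2 (h0 _ _) (h0 _ _) (le_runMax f J n (by omega) ω)
          (le_runMax f J (n+1) (by omega) ω) hM
      have a3 := Finset.sum_le_sum a2
      rw [← Finset.mul_sum, ← Finset.mul_sum] at a3
      simp only [hS]
      linarith
  have h2 : c * ∑ ω, runMax f J ω ^ (p - 2) * S ω ≤ ∑ ω, f J ω ^ p := by
    rw [Finset.mul_sum]
    refine (Finset.sum_le_sum fun ω _ => h1 ω).trans (le_of_eq ?_)
    have : ∀ ω, (f 0 ω ^ p + ∑ n ∈ Finset.range J,
      (f (n + 1) ω ^ p - f n ω ^ p - p * f n ω ^ (p - 1) * (f (n + 1) ω - f n ω)))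
       = f J ω ^ p - ∑ n ∈ Finset.range J, p * f n ω ^ (p - 1) * (f (n + 1) ω - f n ω) := by
      intro ω
      rw [Finset.sum_sub_distrib, Finset.sum_range_sub (fun n => f n ω ^ p)]
      ring
    simp only [this]
    rw [Finset.sum_sub_distrib, Finset.sum_comm, Finset.sum_eq_zero (s := Finset.range J)]
    · simp
    · intro n _
      exact hmart n (fun ω => p * f n ω ^ (p - 1)) (fun ω ω' h => by simp only [hm n ω ω' h])
  have h3 : ∀ ω, S ω ^ (p / 2) ≤ runMax f J ω ^ (p - 2) * S ω + runMax f J ω ^ p := by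
    intro ω
    rcases (hM0 J ω).eq_or_lt with hM | hM
    · have hz : ∀ n ≤ J, f n ω = 0 := fun n hn => le_antisymm (hM ▸ le_runMax f J n hn ω) (h0 n ω)
      have hSz : S ω = 0 := by
        simp only [hS]
        rw [hz 0 (by omega), Finset.sum_eq_zero]; · simp
        intro n hn
        rw [Finset.mem_range] at hn
        rw [hz n (by omega), hz (n+1) (by omega)]; simp
      rw [hSz, Real.zero_rpow (by linarith)]
      simp; exact Real.rpow_nonneg (hM0 _ _) _
    · have g := Real.geom_mean_le_arith_mean2_weighted (w₁ := p / 2) (w₂ := 1 - p / 2)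
        (p₁ := runMax f J ω ^ (p - 2) * S ω) (p₂ := runMax f J ω ^ p) (by linarith) (by linarith)
        (mul_nonneg (Real.rpow_nonneg hM.le _) (hS0 ω)) (Real.rpow_nonneg hM.le _) (by ring)
      have e : (runMax f J ω ^ (p - 2) * S ω) ^ (p / 2) * (runMax f J ω ^ p) ^ (1 - p / 2)
          = S ω ^ (p / 2) := by
        rw [Real.mul_rpow (Real.rpow_nonneg hM.le _) (hS0 ω), ← Real.rpow_mul hM.le,
          ← Real.rpow_mul hM.le, mul_right_comm, ← Real.rpow_add hM,
          show (p - 2) * (p / 2) + p * (1 - p / 2) = 0 by ring, Real.rpow_zero, one_mul]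
      rw [e] at g
      have b1 : 0 ≤ runMax f J ω ^ (p - 2) * S ω := mul_nonneg (Real.rpow_nonneg hM.le _) (hS0 ω)
      have b2 : 0 ≤ runMax f J ω ^ p := Real.rpow_nonneg hM.le _
      nlinarith
  have h4 := Finset.sum_le_sum (s := Finset.univ) fun ω _ => h3 ω
  rw [Finset.sum_add_distrib] at h4
  have h5 := doob R f hp hR hm h0 hmart J
  have h6 : ∑ ω, runMax f J ω ^ (p - 2) * S ω ≤ 2 / (p * (p - 1)) * ∑ ω, f J ω ^ p := by
    rw [show 2 / (p * (p - 1)) = 1 / c by rw [hcdef]; field_simp, div_mul_eq_mul_div, one_mul,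
      le_div_iff₀ hc0, mul_comm]
    exact h2
  rw [add_mul]
  linarith
end mart


section rota
variable {G : Type*} [AddCommGroup G] [Fintype G] {V : Type*} [Fintype V] [Nonempty V]

/-- average of translates -/
noncomputable def av {ι : Type*} {G : Type*} [AddCommGroup G] (W : Finset ι) (s : ι → G)
    (f : G → ℝ) (x : G) : ℝ :=
  (W.card : ℝ)⁻¹ * ∑ w ∈ W, f (x + s w)

/-- iterated averages -/
noncomputable def itav (v : ℕ → V → G) (f : G → ℝ) : ℕ → G → ℝ
  | 0 => f
  | j + 1 => av Finset.univ (v j) (itav v f j)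

/-- position -/
def posn (v : ℕ → V → G) (J j : ℕ) (ω : G × (Fin J → V)) : G :=
  ω.1 - ∑ i : Fin J, if i.1 < j then v i (ω.2 i) else 0

noncomputable def Tav (v : ℕ → V → G) (J j : ℕ) (f : G → ℝ) (x : G) : ℝ :=
  (Fintype.card (Fin J → V) : ℝ)⁻¹ * ∑ e : Fin J → V, itav v f j (posn v J j (x, e))

lemma posn_zero (v : ℕ → V → G) (J : ℕ) (ω : G × (Fin J → V)) : posn v J 0 ω = ω.1 := by
  simp [posn]

lemma posn_succ (v : ℕ → V → G) (J j : ℕ) (hj : j < J) (ω : G × (Fin J → V)) :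
    posn v J (j + 1) ω = posn v J j ω - v j (ω.2 ⟨j, hj⟩) := by
  have : (∑ i : Fin J, if i.1 < j + 1 then v i (ω.2 i) else 0) =
      (∑ i : Fin J, if i.1 < j then v i (ω.2 i) else 0) + v j (ω.2 ⟨j, hj⟩) := by
    have h2 : v j (ω.2 ⟨j, hj⟩) = ∑ i : Fin J, if i = ⟨j, hj⟩ then v i (ω.2 i) else 0 := by
      simp
    rw [h2, ← Finset.sum_add_distrib]
    refine Finset.sum_congr rfl fun i _ => ?_
    by_cases h : i = ⟨j, hj⟩
    · subst h; simp
    · have : i.1 ≠ j := fun h' => h (Fin.ext h')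
      by_cases h3 : i.1 < j
      · simp [h, h3, Nat.lt_succ_of_lt h3]
      · have : ¬ i.1 < j + 1 := by omega
        simp [h, h3, this]
  simp only [posn, this]
  abel

/-- resampling -/
def resamp (v : ℕ → V → G) (J j : ℕ) (hj : j < J) (q : (G × (Fin J → V)) × V) :
    (G × (Fin J → V)) × V :=
  ((q.1.1 - v j (q.1.2 ⟨j, hj⟩) + v j q.2, Function.update q.1.2 ⟨j, hj⟩ q.2), q.1.2 ⟨j, hj⟩)

lemma resamp_inv (v : ℕ → V → G) (J j : ℕ) (hj : j < J) :
    Function.Involutive (resamp v J j hj) := by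
  rintro ⟨⟨x, e⟩, a⟩
  simp [resamp]

lemma posn_resamp (v : ℕ → V → G) (J j : ℕ) (hj : j < J) (q : (G × (Fin J → V)) × V) :
    posn v J j (resamp v J j hj q).1 = posn v J (j + 1) q.1 + v j q.2 := by
  rw [posn_succ v J j hj]
  simp only [posn, resamp]
  have : (∑ i : Fin J, if i.1 < j then v i (Function.update q.1.2 ⟨j, hj⟩ q.2 i) else 0) =
      ∑ i : Fin J, if i.1 < j then v i (q.1.2 i) else 0 := by
    refine Finset.sum_congr rfl fun i _ => ?_
    by_cases h : i.1 < j
    · have : i ≠ ⟨j, hj⟩ := by intro h'; subst h'; simp at h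
      simp [h, this]
    · simp [h]
  rw [this]; abel

def PRel (v : ℕ → V → G) (J j : ℕ) (ω ω' : G × (Fin J → V)) : Prop :=
  posn v J j ω = posn v J j ω' ∧ ∀ i : Fin J, j ≤ i.1 → ω.2 i = ω'.2 i

lemma rel_succ (v : ℕ → V → G) (J j : ℕ) (hj : j < J) (ω ω' : G × (Fin J → V))
    (h : PRel v J j ω ω') : PRel v J (j + 1) ω ω' := by
  refine ⟨?_, fun i hi => h.2 i (by omega)⟩
  rw [posn_succ v J j hj, posn_succ v J j hj, h.1, h.2 ⟨j, hj⟩ le_rfl]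

lemma rel_resamp (v : ℕ → V → G) (J j : ℕ) (hj : j < J) (q : (G × (Fin J → V)) × V) :
    PRel v J (j + 1) (resamp v J j hj q).1 q.1 := by
  refine ⟨?_, fun i hi => ?_⟩
  · rw [posn_succ v J j hj, posn_resamp]; simp [resamp]
  · have : i ≠ ⟨j, hj⟩ := by intro h'; subst h'; simp at hi
    simp [resamp, this]

lemma mart_step (v : ℕ → V → G) (J j : ℕ) (hj : j < J) (f : G → ℝ) (h : G × (Fin J → V) → ℝ)
    (hh : ∀ ω ω', PRel v J (j + 1) ω ω' → h ω = h ω') :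
    ∑ ω, h ω * (itav v f j (posn v J j ω) - itav v f (j + 1) (posn v J (j + 1) ω)) = 0 := by
  have hV : (Fintype.card V : ℝ) ≠ 0 := by simp
  have h1 : ∑ q : (G × (Fin J → V)) × V, h q.1 * itav v f j (posn v J j q.1) =
      ∑ q : (G × (Fin J → V)) × V, h q.1 * itav v f j (posn v J (j + 1) q.1 + v j q.2) := by
    rw [← Equiv.sum_comp (resamp_inv v J j hj).toPerm]
    refine Finset.sum_congr rfl fun q _ => ?_
    simp only [Function.Involutive.coe_toPerm]
    rw [posn_resamp, hh _ _ (rel_resamp v J j hj q)]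
  rw [Fintype.sum_prod_type (fun q : (G × (Fin J → V)) × V => h q.1 * itav v f j (posn v J j q.1)),
    Fintype.sum_prod_type (fun q : (G × (Fin J → V)) × V =>
      h q.1 * itav v f j (posn v J (j + 1) q.1 + v j q.2))] at h1
  simp only [Finset.sum_const, nsmul_eq_mul, Finset.card_univ, ← Finset.mul_sum] at h1
  simp only [mul_sub, Finset.sum_sub_distrib, sub_eq_zero]
  apply mul_left_cancel₀ hV
  rw [h1, Finset.mul_sum]
  refine Finset.sum_congr rfl fun ω _ => ?_
  simp only [itav, av, Finset.card_univ]
  field_simp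

lemma av_nonneg {ι : Type*} (W : Finset ι) (s : ι → G) {f : G → ℝ} (hf : ∀ x, 0 ≤ f x) (x : G) :
    0 ≤ av W s f x := mul_nonneg (by positivity) (Finset.sum_nonneg fun _ _ => hf _)

lemma itav_nonneg (v : ℕ → V → G) {f : G → ℝ} (hf : ∀ x, 0 ≤ f x) (j : ℕ) (x : G) :
    0 ≤ itav v f j x := by
  induction j generalizing x with
  | zero => exact hf x
  | succ j ih => exact av_nonneg _ _ ih x

lemma Tav_nonneg (v : ℕ → V → G) (J j : ℕ) {f : G → ℝ} (hf : ∀ x, 0 ≤ f x) (x : G) :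
    0 ≤ Tav v J j f x :=
  mul_nonneg (by positivity) (Finset.sum_nonneg fun _ _ => itav_nonneg v hf _ _)

lemma jensen_avg {E : Type*} [Fintype E] [Nonempty E] {p : ℝ} (hp : 1 ≤ p) (g : E → ℝ)
    (hg : ∀ e, 0 ≤ g e) :
    ((Fintype.card E : ℝ)⁻¹ * ∑ e, g e) ^ p ≤ (Fintype.card E : ℝ)⁻¹ * ∑ e, g e ^ p := by
  rw [Finset.mul_sum, Finset.mul_sum]
  exact Real.rpow_arith_mean_le_arith_mean_rpow Finset.univ (fun _ => (Fintype.card E : ℝ)⁻¹) g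
    (fun _ _ => by positivity) (by simp) (fun e _ => hg e) hp

variable (v : ℕ → V → G) (J : ℕ)

/-- the forward martingale -/
noncomputable def Fm (f : G → ℝ) (n : ℕ) (ω : G × (Fin J → V)) : ℝ :=
  itav v f (J - n) (posn v J (J - n) ω)

lemma Fm_props {f : G → ℝ} (hf : ∀ x, 0 ≤ f x) :
    (∀ n ω ω', PRel v J (J - (n + 1)) ω ω' → PRel v J (J - n) ω ω') ∧
    (∀ n ω ω', PRel v J (J - n) ω ω' → Fm v J f n ω = Fm v J f n ω') ∧
    (∀ n ω, 0 ≤ Fm v J f n ω) ∧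
    (∀ n (h : _ → ℝ), (∀ ω ω', PRel v J (J - n) ω ω' → h ω = h ω') →
      ∑ ω, h ω * (Fm v J f (n + 1) ω - Fm v J f n ω) = 0) := by
  refine ⟨?_, ?_, ?_, ?_⟩
  · intro n ω ω' h
    rcases Nat.lt_or_ge n J with hn | hn
    · rw [show J - n = (J - (n + 1)) + 1 by omega]
      exact rel_succ v J _ (by omega) _ _ h
    · rwa [show J - n = J - (n + 1) by omega]
  · intro n ω ω' h
    simp only [Fm, h.1]
  · intro n ω
    exact itav_nonneg v hf _ _
  · intro n h hh
    rcases Nat.lt_or_ge n J with hn | hn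
    · have e : J - n = (J - (n + 1)) + 1 := by omega
      rw [e] at hh
      have := mart_step v J (J - (n + 1)) (by omega) f h hh
      simp only [Fm]
      rw [e]; exact this
    · simp only [Fm]
      rw [show J - n = J - (n + 1) by omega]; simp

lemma Fm_last (f : G → ℝ) (ω : G × (Fin J → V)) : Fm v J f J ω = f ω.1 := by
  simp [Fm, posn_zero, itav]

lemma sum_last {p : ℝ} (f : G → ℝ) : ∑ ω, Fm v J f J ω ^ p =
    Fintype.card (Fin J → V) * ∑ x, f x ^ p := by
  rw [Fintype.sum_prod_type]
  simp only [Fm_last, Finset.sum_const, Finset.card_univ, nsmul_eq_mul, Finset.mul_sum]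

theorem Tav_max {p : ℝ} (hp : 1 < p) {f : G → ℝ} (hf : ∀ x, 0 ≤ f x) (k : G → ℕ)
    (hk : ∀ x, k x ≤ J) :
    ∑ x, Tav v J (k x) f x ^ p ≤ (p / (p - 1)) ^ p * ∑ x, f x ^ p := by
  obtain ⟨h1, h2, h3, h4⟩ := Fm_props v J hf
  have hd := doob (fun n => PRel v J (J - n)) (Fm v J f) hp h1 h2 h3 h4 J
  rw [sum_last, Fintype.sum_prod_type] at hd
  have hE : (0:ℝ) < Fintype.card (Fin J → V) := by exact_mod_cast Fintype.card_pos
  calc ∑ x, Tav v J (k x) f x ^ p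
      ≤ ∑ x, (Fintype.card (Fin J → V) : ℝ)⁻¹ * ∑ e, runMax (Fm v J f) J (x, e) ^ p := by
        refine Finset.sum_le_sum fun x _ => ?_
        refine le_trans ?_ (jensen_avg hp.le _ (fun e => (h3 0 (x, e)).trans
          (le_runMax _ _ _ (by omega) _)))
        refine Real.rpow_le_rpow (Tav_nonneg v J _ hf x) ?_ (by linarith)
        refine mul_le_mul_of_nonneg_left (Finset.sum_le_sum fun e _ => ?_) (by positivity)
        have := le_runMax (Fm v J f) J (J - k x) (by omega) (x, e)
        simp only [Fm] at this
        rwa [show J - (J - k x) = k x by have := hk x; omega] at this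
    _ ≤ _ := by
        rw [← Finset.mul_sum, inv_mul_le_iff₀ hE]
        linarith

lemma mink {E : Type*} [Fintype E] (n : ℕ) (D : ℕ → E → ℝ) :
    Real.sqrt (∑ j ∈ Finset.range n, (∑ e, D j e) ^ 2) ≤
      ∑ e, Real.sqrt (∑ j ∈ Finset.range n, D j e ^ 2) := by
  have h := norm_sum_le Finset.univ (fun e : E => (WithLp.toLp 2 (fun j : Fin n => D j e) :
    EuclideanSpace ℝ (Fin n)))
  simp only [EuclideanSpace.norm_eq, Real.norm_eq_abs, sq_abs, WithLp.ofLp_sum, Finset.sum_apply] at h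
  simp only [Finset.sum_range]
  exact h

/-- difference operators -/
noncomputable def Dop (j : ℕ) (f : G → ℝ) (x : G) : ℝ :=
  if j < J then Tav v J j f x - Tav v J (j + 1) f x else Tav v J j f x

theorem Dop_sq_pos {p : ℝ} (hp : 1 < p) (hp2 : p < 2) {f : G → ℝ} (hf : ∀ x, 0 ≤ f x) :
    ∑ x, (∑ j ∈ Finset.range (J + 1), Dop v J j f x ^ 2) ^ (p / 2) ≤
      (2 / (p * (p - 1)) + (p / (p - 1)) ^ p) * ∑ x, f x ^ p := by
  obtain ⟨h1, h2, h3, h4⟩ := Fm_props v J hf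
  have hd := sqfun (fun n => PRel v J (J - n)) (Fm v J f) hp hp2 h1 h2 h3 h4 J
  rw [sum_last, Fintype.sum_prod_type] at hd
  have hE : (0:ℝ) < Fintype.card (Fin J → V) := by exact_mod_cast Fintype.card_pos
  set K : ℝ := ((Fintype.card (Fin J → V) : ℕ) : ℝ) with hK
  let D : ℕ → G → (Fin J → V) → ℝ := fun j x e =>
    if j < J then itav v f j (posn v J j (x, e)) - itav v f (j + 1) (posn v J (j + 1) (x, e))
    else itav v f j (posn v J j (x, e))
  have hD : ∀ j x, Dop v J j f x = K⁻¹ * ∑ e, D j x e := by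
    intro j x
    simp only [Dop, D, Tav]
    split_ifs
    · rw [← mul_sub, ← Finset.sum_sub_distrib]
    · rfl
  have hS : ∀ x e, (Fm v J f 0 (x, e) ^ 2 + ∑ n ∈ Finset.range J,
      (Fm v J f (n + 1) (x, e) - Fm v J f n (x, e)) ^ 2) = ∑ j ∈ Finset.range (J + 1), D j x e ^ 2 := by
    intro x e
    rw [Finset.sum_range_succ, add_comm]
    congr 1
    · rw [← Finset.sum_range_reflect]
      refine Finset.sum_congr rfl fun n hn => ?_
      rw [Finset.mem_range] at hn
      simp only [D, Fm, hn, if_true]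
      rw [show J - (J - 1 - n + 1) = n by omega, show J - (J - 1 - n) = n + 1 by omega]
    · simp [D, Fm]
  calc _ ≤ ∑ x, K⁻¹ * ∑ e, (∑ j ∈ Finset.range (J + 1), D j x e ^ 2) ^ (p / 2) := by
        refine Finset.sum_le_sum fun x _ => ?_
        have e0 : ∀ y : ℝ, 0 ≤ y → y ^ (p / 2) = (Real.sqrt y) ^ p := by
          intro y hy
          rw [Real.sqrt_eq_rpow, ← Real.rpow_mul hy]; congr 1; ring
        rw [e0 _ (Finset.sum_nonneg fun _ _ => sq_nonneg _)]
        have e1 : ∀ e, (∑ j ∈ Finset.range (J + 1), D j x e ^ 2) ^ (p / 2) =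
            (Real.sqrt (∑ j ∈ Finset.range (J + 1), D j x e ^ 2)) ^ p :=
          fun e => e0 _ (Finset.sum_nonneg fun _ _ => sq_nonneg _)
        simp only [e1]
        refine le_trans ?_ (jensen_avg hp.le _ (fun e => Real.sqrt_nonneg _))
        refine Real.rpow_le_rpow (Real.sqrt_nonneg _) ?_ (by linarith)
        simp only [hD, mul_pow, ← Finset.mul_sum]
        rw [Real.sqrt_mul (by positivity), Real.sqrt_sq (by positivity)]
        exact mul_le_mul_of_nonneg_left (mink _ _) (by positivity)
    _ ≤ _ := by
        rw [← Finset.mul_sum, inv_mul_le_iff₀ hE]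
        simp only [← hS]
        linarith

lemma av_sub {ι : Type*} (W : Finset ι) (s : ι → G) (f g : G → ℝ) (x : G) :
    av W s (fun y => f y - g y) x = av W s f x - av W s g x := by
  simp [av, mul_sub]

lemma itav_sub (f g : G → ℝ) (j : ℕ) (x : G) :
    itav v (fun y => f y - g y) j x = itav v f j x - itav v g j x := by
  induction j generalizing x with
  | zero => rfl
  | succ j ih =>
    simp only [itav]
    rw [← av_sub]
    congr 1
    funext y; exact ih y

lemma Tav_sub (j : ℕ) (f g : G → ℝ) (x : G) :
    Tav v J j (fun y => f y - g y) x = Tav v J j f x - Tav v J j g x := by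
  simp [Tav, itav_sub, mul_sub]

lemma Dop_sub (j : ℕ) (f g : G → ℝ) (x : G) :
    Dop v J j (fun y => f y - g y) x = Dop v J j f x - Dop v J j g x := by
  simp only [Dop, Tav_sub]; split_ifs <;> ring

theorem Dop_sq {p : ℝ} (hp : 1 < p) (hp2 : p < 2) (f : G → ℝ) :
    ∑ x, (∑ j ∈ Finset.range (J + 1), Dop v J j f x ^ 2) ^ (p / 2) ≤
      4 * (2 / (p * (p - 1)) + (p / (p - 1)) ^ p) * ∑ x, |f x| ^ p := by
  have hC : 0 ≤ (2 / (p * (p - 1)) + (p / (p - 1)) ^ p) := by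
    have : 0 < p - 1 := by linarith
    positivity
  have ha := Dop_sq_pos v J hp hp2 (f := fun x => max (f x) 0) (fun x => le_max_right _ _)
  have hb := Dop_sq_pos v J hp hp2 (f := fun x => max (-f x) 0) (fun x => le_max_right _ _)
  have ha' : ∑ x, max (f x) 0 ^ p ≤ ∑ x, |f x| ^ p := Finset.sum_le_sum fun x _ =>
    Real.rpow_le_rpow (le_max_right _ _) (max_le (le_abs_self _) (abs_nonneg _)) (by linarith)
  have hb' : ∑ x, max (-f x) 0 ^ p ≤ ∑ x, |f x| ^ p := Finset.sum_le_sum fun x _ =>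
    Real.rpow_le_rpow (le_max_right _ _) (max_le (neg_le_abs _) (abs_nonneg _)) (by linarith)
  have hf : f = fun x => max (f x) 0 - max (-f x) 0 := by
    funext x
    rcases le_total (f x) 0 with h | h
    · rw [max_eq_right h, max_eq_left (by linarith)]; ring
    · rw [max_eq_left h, max_eq_right (by linarith)]; ring
  have key : ∑ x, (∑ j ∈ Finset.range (J + 1), Dop v J j f x ^ 2) ^ (p / 2) ≤
      ∑ x, (2 * (∑ j ∈ Finset.range (J + 1), Dop v J j (fun x => max (f x) 0) x ^ 2) ^ (p / 2)
        + 2 * (∑ j ∈ Finset.range (J + 1), Dop v J j (fun x => max (-f x) 0) x ^ 2) ^ (p / 2)) := by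
    refine Finset.sum_le_sum fun x _ => ?_
    set a := ∑ j ∈ Finset.range (J + 1), Dop v J j (fun x => max (f x) 0) x ^ 2
    set b := ∑ j ∈ Finset.range (J + 1), Dop v J j (fun x => max (-f x) 0) x ^ 2
    have ha0 : 0 ≤ a := Finset.sum_nonneg fun _ _ => sq_nonneg _
    have hb0 : 0 ≤ b := Finset.sum_nonneg fun _ _ => sq_nonneg _
    have h1 : ∑ j ∈ Finset.range (J + 1), Dop v J j f x ^ 2 ≤ 2 * (a + b) := by
      rw [← Finset.sum_add_distrib, Finset.mul_sum]
      refine Finset.sum_le_sum fun j _ => ?_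
      nth_rewrite 1 [hf]
      rw [Dop_sub]
      nlinarith [sq_nonneg (Dop v J j (fun x => max (f x) 0) x + Dop v J j (fun x => max (-f x) 0) x)]
    calc _ ≤ (2 * (a + b)) ^ (p / 2) :=
          Real.rpow_le_rpow (Finset.sum_nonneg fun _ _ => sq_nonneg _) h1 (by linarith)
      _ = 2 ^ (p / 2) * (a + b) ^ (p / 2) := Real.mul_rpow (by norm_num) (by positivity)
      _ ≤ 2 * (a ^ (p / 2) + b ^ (p / 2)) := by
          apply mul_le_mul
          · calc (2:ℝ) ^ (p / 2) ≤ 2 ^ (1:ℝ) :=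
                Real.rpow_le_rpow_of_exponent_le (by norm_num) (by linarith)
              _ = 2 := by simp
          · exact Real.rpow_add_le_add_rpow ha0 hb0 (by linarith) (by linarith)
          · positivity
          · norm_num
      _ = _ := by ring
  rw [Finset.sum_add_distrib, ← Finset.mul_sum, ← Finset.mul_sum] at key
  nlinarith [mul_le_mul_of_nonneg_left ha' hC, mul_le_mul_of_nonneg_left hb' hC]
end rota


section vec
variable {G : Type*} [AddCommGroup G] [Fintype G] {ι : Type*}

lemma sum_av (W : Finset ι) (hW : W.Nonempty) (s : ι → G) (f : G → ℝ) :
    ∑ x, av W s f x = ∑ x, f x := by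
  simp only [av]
  rw [← Finset.mul_sum, Finset.sum_comm]
  have : ∀ w, ∑ x, f (x + s w) = ∑ x, f x := fun w => Equiv.sum_comp (Equiv.addRight (s w)) f
  simp only [this, Finset.sum_const, nsmul_eq_mul]
  have : (W.card : ℝ) ≠ 0 := by exact_mod_cast hW.card_pos.ne'
  field_simp

lemma av_cs (W : Finset ι) (s : ι → G) (g u w : G → ℝ) (hu : ∀ x, 0 ≤ u x) (hw : ∀ x, 0 ≤ w x)
    (h : ∀ x, g x ^ 2 = u x * w x) (x : G) : av W s g x ^ 2 ≤ av W s u x * av W s w x := by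
  simp only [av]
  have := Finset.sum_sq_le_sum_mul_sum_of_sq_eq_mul W (r := fun i => g (x + s i))
    (f := fun i => u (x + s i)) (g := fun i => w (x + s i)) (fun i _ => hu _) (fun i _ => hw _)
    (fun i _ => h _)
  rw [mul_pow]
  calc _ ≤ ((W.card : ℝ)⁻¹) ^ 2 * _ := mul_le_mul_of_nonneg_left this (by positivity)
    _ = _ := by ring

theorem vec_bound (W : ℕ → Finset ι) (hW : ∀ j, (W j).Nonempty) (s : ι → G) (I : Finset ℕ)
    {p0 B : ℝ} (hp0 : 1 < p0)
    (H : ∀ f : G → ℝ, (∀ x, 0 ≤ f x) → ∀ k : G → ℕ, (∀ x, k x ∈ I) →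
      ∑ x, av (W (k x)) s f x ^ p0 ≤ B * ∑ x, f x ^ p0)
    (g : ℕ → G → ℝ) :
    ∑ x, (∑ j ∈ I, av (W j) s (g j) x ^ 2) ^ (p0 / (1 + p0)) ≤
      (B + 1) * ∑ x, (∑ j ∈ I, g j x ^ 2) ^ (p0 / (1 + p0)) := by
  rcases I.eq_empty_or_nonempty with hI | hI
  · subst hI
    simp [Real.zero_rpow (show p0 / (1 + p0) ≠ 0 by positivity)]
  set r : ℝ := 1 / (1 + p0) with hr
  have hr0 : 0 < r := by positivity
  have hr1 : p0 / (1 + p0) = 1 - r := by rw [hr]; field_simp; ring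
  have hr2 : 0 < 1 - r := by rw [← hr1]; positivity
  have hrp : r * p0 = 1 - r := by rw [← hr1, hr]; ring
  rw [hr1]
  set Q : G → ℝ := fun x => ∑ j ∈ I, g j x ^ 2 with hQ
  have hQ0 : ∀ x, 0 ≤ Q x := fun x => Finset.sum_nonneg fun _ _ => sq_nonneg _
  set v : G → ℝ := fun x => Q x ^ r with hv
  set u : ℕ → G → ℝ := fun j x => g j x ^ 2 * Q x ^ (-r) with hu
  have hv0 : ∀ x, 0 ≤ v x := fun x => Real.rpow_nonneg (hQ0 x) _
  have hu0 : ∀ j x, 0 ≤ u j x := fun j x => mul_nonneg (sq_nonneg _) (Real.rpow_nonneg (hQ0 x) _)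
  have huv : ∀ j ∈ I, ∀ x, g j x ^ 2 = u j x * v x := by
    intro j hj x
    rcases (hQ0 x).eq_or_lt with h | h
    · have : g j x ^ 2 = 0 := (Finset.sum_eq_zero_iff_of_nonneg (fun _ _ => sq_nonneg _)).1 h.symm j hj
      simp only [hu, this]; simp
    · simp only [hu, hv]
      rw [mul_assoc, ← Real.rpow_add h]; simp
  have hsum : ∀ x, ∑ j ∈ I, u j x = Q x ^ (1 - r) := by
    intro x
    simp only [hu]
    rw [← Finset.sum_mul]
    change Q x * Q x ^ (-r) = _
    rcases (hQ0 x).eq_or_lt with h | h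
    · rw [← h, Real.zero_rpow hr2.ne']; simp
    · nth_rewrite 1 [← Real.rpow_one (Q x)]
      rw [← Real.rpow_add h]; congr 1
  have hk : ∀ x, ∃ k ∈ I, ∀ j ∈ I, av (W j) s v x ≤ av (W k) s v x := fun x =>
    Finset.exists_max_image I (fun j => av (W j) s v x) hI
  choose k hkI hk using hk
  have Hv := H v hv0 k hkI
  have hvp : ∀ x, v x ^ p0 = Q x ^ (1 - r) := by
    intro x
    simp only [hv]
    rw [← Real.rpow_mul (hQ0 x), hrp]
  simp only [hvp] at Hv
  have pt : ∀ x, (∑ j ∈ I, av (W j) s (g j) x ^ 2) ^ (1 - r) ≤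
      av (W (k x)) s v x ^ p0 + ∑ j ∈ I, av (W j) s (u j) x := by
    intro x
    have hm0 := av_nonneg (W (k x)) s hv0 x
    have hU0 : 0 ≤ ∑ j ∈ I, av (W j) s (u j) x := Finset.sum_nonneg fun j _ => av_nonneg _ _ (hu0 j) x
    have h1 : ∑ j ∈ I, av (W j) s (g j) x ^ 2 ≤
        av (W (k x)) s v x * ∑ j ∈ I, av (W j) s (u j) x := by
      rw [Finset.mul_sum]
      refine Finset.sum_le_sum fun j hj => ?_
      refine (av_cs (W j) s (g j) (u j) v (hu0 j) hv0 (huv j hj) x).trans ?_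
      rw [mul_comm]
      exact mul_le_mul_of_nonneg_right (hk x j hj) (av_nonneg _ _ (hu0 j) x)
    refine (Real.rpow_le_rpow (Finset.sum_nonneg fun _ _ => sq_nonneg _) h1 hr2.le).trans ?_
    rw [Real.mul_rpow hm0 hU0, ← hrp, mul_comm r p0, Real.rpow_mul hm0, mul_comm p0 r, hrp]
    refine (Real.geom_mean_le_arith_mean2_weighted hr0.le hr2.le (Real.rpow_nonneg hm0 _) hU0
      (by ring)).trans ?_
    have := Real.rpow_nonneg hm0 p0
    nlinarith
  refine (Finset.sum_le_sum fun x _ => pt x).trans ?_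
  rw [Finset.sum_add_distrib, Finset.sum_comm]
  simp only [sum_av _ (hW _)]
  rw [Finset.sum_comm]
  simp only [hsum]
  linarith

end vec

section marc
open MeasureTheory Set

lemma lint_low {q y : ℝ} (hq : 0 < q) (hy : 0 ≤ y) :
    ∫⁻ t in Ioi (0:ℝ), ENNReal.ofReal ((Iio y).indicator (fun t => t ^ (q - 1)) t) =
      ENNReal.ofReal (y ^ q / q) := by
  have h1 : ∀ t, ENNReal.ofReal ((Iio y).indicator (fun t => t ^ (q - 1)) t) =
      (Iio y).indicator (fun t => ENNReal.ofReal (t ^ (q - 1))) t := by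
    intro t; by_cases h : t ∈ Iio y <;> simp [h]
  simp only [h1]
  rw [lintegral_indicator measurableSet_Iio, Measure.restrict_restrict measurableSet_Iio]
  rw [show Iio y ∩ Ioi 0 = Ioo 0 y by ext; simp [and_comm]]
  have hi : IntegrableOn (fun t : ℝ => t ^ (q - 1)) (Ioo 0 y) := by
    have := intervalIntegral.intervalIntegrable_rpow' (a := 0) (b := y) (r := q - 1) (by linarith)
    rw [intervalIntegrable_iff_integrableOn_Ioo_of_le hy] at this
    exact this
  rw [← ofReal_integral_eq_lintegral_ofReal hi]
  · rw [← integral_Ioc_eq_integral_Ioo, ← intervalIntegral.integral_of_le hy,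
      integral_rpow (Or.inl (by linarith))]
    simp [Real.zero_rpow hq.ne']
  · refine (ae_restrict_iff' measurableSet_Ioo).2 (Filter.Eventually.of_forall fun t ht => ?_)
    exact Real.rpow_nonneg ht.1.le _

lemma lint_high {q y : ℝ} (hq : 0 < q) (hy : 0 < y) :
    ∫⁻ t in Ioi (0:ℝ), ENNReal.ofReal ((Ici y).indicator (fun t => t ^ (-q - 1)) t) =
      ENNReal.ofReal (y ^ (-q) / q) := by
  have h1 : ∀ t, ENNReal.ofReal ((Ici y).indicator (fun t => t ^ (-q - 1)) t) =
      (Ici y).indicator (fun t => ENNReal.ofReal (t ^ (-q - 1))) t := by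
    intro t; by_cases h : t ∈ Ici y <;> simp [h]
  simp only [h1]
  rw [lintegral_indicator measurableSet_Ici, Measure.restrict_restrict measurableSet_Ici]
  rw [show Ici y ∩ Ioi 0 = Ici y by
    ext t; simp only [mem_inter_iff, mem_Ici, mem_Ioi, and_iff_left_iff_imp]; intro h; linarith]
  rw [setLIntegral_congr Ioi_ae_eq_Ici.symm]
  have hi : IntegrableOn (fun t : ℝ => t ^ (-q - 1)) (Ioi y) :=
    integrableOn_Ioi_rpow_of_lt (by linarith) hy
  rw [← ofReal_integral_eq_lintegral_ofReal hi]
  · rw [integral_Ioi_rpow_of_lt (by linarith) hy]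
    congr 1
    rw [show -q - 1 + 1 = -q by ring]; field_simp
  · refine (ae_restrict_iff' measurableSet_Ioi).2 (Filter.Eventually.of_forall fun t ht => ?_)
    exact Real.rpow_nonneg (hy.trans ht).le _

variable {G : Type*} [Fintype G]

theorem marcin {p1 p C1 C2 η : ℝ} (hp1 : 1 < p1) (hp : p1 < p) (hp2 : p < 2) (hC1 : 0 ≤ C1)
    (hC2 : 0 ≤ C2) (hη : 0 < η) (Q : (G → ℝ) → G → ℝ)
    (hQ0 : ∀ f x, 0 ≤ Q f x)
    (hsub : ∀ f g x, Q (fun y => f y + g y) x ≤ Q f x + Q g x)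
    (h1 : ∀ f, ∑ x, Q f x ^ p1 ≤ C1 * ∑ x, |f x| ^ p1)
    (h2 : ∀ f, ∑ x, Q f x ^ 2 ≤ C2 * ∑ x, f x ^ 2) (f : G → ℝ) :
    ∑ x, Q f x ^ p ≤ 2 ^ p * p * (C1 / (p - p1) * η ^ (p1 - p) + C2 / (2 - p) * η ^ (2 - p)) *
      ∑ x, |f x| ^ p := by
  have hpp : 0 < p := by linarith
  -- distributional inequality
  have dist : ∀ t : ℝ, 0 < t → ∑ x, (Iio (Q f x / 2)).indicator (fun t => t ^ (p - 1)) t ≤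
      ∑ x, (C1 * |f x| ^ p1 * (Iio (|f x| / η)).indicator (fun t => t ^ (p - p1 - 1)) t +
        C2 * f x ^ 2 * (Ici (|f x| / η)).indicator (fun t => t ^ (-(2 - p) - 1)) t) := by
    intro t ht
    set a : G → ℝ := fun x => if t < |f x| / η then f x else 0 with ha
    set b : G → ℝ := fun x => if t < |f x| / η then 0 else f x with hb
    have hab : f = fun x => a x + b x := by
      funext x; simp only [ha, hb]; split_ifs <;> simp
    have e1 : ∀ x, (Iio (Q f x / 2)).indicator (fun t => t ^ (p - 1)) t ≤
        t ^ (p - p1 - 1) * Q a x ^ p1 + t ^ (-(2 - p) - 1) * Q b x ^ 2 := by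
      intro x
      have n1 : 0 ≤ t ^ (p - p1 - 1) * Q a x ^ p1 :=
        mul_nonneg (Real.rpow_nonneg ht.le _) (Real.rpow_nonneg (hQ0 _ _) _)
      have n2 : 0 ≤ t ^ (-(2 - p) - 1) * Q b x ^ 2 :=
        mul_nonneg (Real.rpow_nonneg ht.le _) (sq_nonneg _)
      by_cases hx : t ∈ Iio (Q f x / 2)
      · rw [indicator_of_mem hx]
        rw [mem_Iio] at hx
        have hs : Q f x ≤ Q a x + Q b x := by
          have := hsub a b x
          rwa [← hab] at this
        rcases lt_or_ge t (Q a x) with h | h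
        · have : t ^ (p - 1) ≤ t ^ (p - p1 - 1) * Q a x ^ p1 := by
            calc t ^ (p - 1) = t ^ (p - p1 - 1) * t ^ p1 := by
                  rw [← Real.rpow_add ht]; congr 1; ring
              _ ≤ _ := mul_le_mul_of_nonneg_left (Real.rpow_le_rpow ht.le h.le (by linarith))
                  (Real.rpow_nonneg ht.le _)
          linarith
        · have hb' : t ≤ Q b x := by linarith
          have : t ^ (p - 1) ≤ t ^ (-(2 - p) - 1) * Q b x ^ 2 := by
            calc t ^ (p - 1) = t ^ (-(2 - p) - 1) * t ^ 2 := by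
                  rw [← Real.rpow_two, ← Real.rpow_add ht]; congr 1; ring
              _ ≤ _ := mul_le_mul_of_nonneg_left (pow_le_pow_left₀ ht.le hb' 2)
                  (Real.rpow_nonneg ht.le _)
          linarith
      · rw [indicator_of_notMem hx]; linarith
    refine (Finset.sum_le_sum fun x _ => e1 x).trans ?_
    rw [Finset.sum_add_distrib, Finset.sum_add_distrib, ← Finset.mul_sum, ← Finset.mul_sum]
    refine add_le_add ?_ ?_
    · refine (mul_le_mul_of_nonneg_left (h1 a) (Real.rpow_nonneg ht.le _)).trans (le_of_eq ?_)
      rw [Finset.mul_sum, Finset.mul_sum]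
      refine Finset.sum_congr rfl fun x _ => ?_
      by_cases hx : t < |f x| / η
      · rw [indicator_of_mem (show t ∈ Iio (|f x| / η) from hx)]
        simp only [ha, hx, if_true]; ring
      · rw [indicator_of_notMem (show t ∉ Iio (|f x| / η) from hx)]
        simp [ha, hx, Real.zero_rpow (show p1 ≠ 0 by linarith)]
    · refine (mul_le_mul_of_nonneg_left (h2 b) (Real.rpow_nonneg ht.le _)).trans (le_of_eq ?_)
      rw [Finset.mul_sum, Finset.mul_sum]
      refine Finset.sum_congr rfl fun x _ => ?_
      by_cases hx : t < |f x| / η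
      · rw [indicator_of_notMem (show t ∉ Ici (|f x| / η) from not_le.2 hx)]
        simp [hb, hx]
      · rw [indicator_of_mem (show t ∈ Ici (|f x| / η) from not_lt.1 hx)]
        simp only [hb, hx, if_false]; ring
  have hind0 : ∀ (S : Set ℝ) (q t : ℝ), 0 < t → 0 ≤ S.indicator (fun t => t ^ q) t := by
    intro S q t ht
    by_cases h : t ∈ S
    · rw [indicator_of_mem h]; exact Real.rpow_nonneg ht.le _
    · rw [indicator_of_notMem h]
  have hmeas : ∀ (S : Set ℝ) (q : ℝ), MeasurableSet S →
      Measurable (fun t => S.indicator (fun t : ℝ => t ^ q) t) := by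
    intro S q hS
    exact (measurable_id.pow_const q).indicator hS
  have L : ∑ x, ENNReal.ofReal ((Q f x / 2) ^ p / p) ≤
      ∑ x, (ENNReal.ofReal (C1 * |f x| ^ p1) * ENNReal.ofReal ((|f x| / η) ^ (p - p1) / (p - p1)) +
        ENNReal.ofReal (C2 * f x ^ 2) * ENNReal.ofReal ((|f x| / η) ^ (-(2 - p)) / (2 - p))) := by
    calc ∑ x, ENNReal.ofReal ((Q f x / 2) ^ p / p)
        = ∑ x, ∫⁻ t in Ioi (0:ℝ), ENNReal.ofReal ((Iio (Q f x / 2)).indicator (fun t => t ^ (p - 1)) t) := by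
          refine Finset.sum_congr rfl fun x _ => ?_
          rw [lint_low hpp (by have := hQ0 f x; positivity)]
      _ = ∫⁻ t in Ioi (0:ℝ), ∑ x, ENNReal.ofReal ((Iio (Q f x / 2)).indicator (fun t => t ^ (p - 1)) t) := by
          rw [lintegral_finsetSum]
          intro x _
          exact (hmeas _ _ measurableSet_Iio).ennreal_ofReal
      _ ≤ ∫⁻ t in Ioi (0:ℝ), ∑ x, (ENNReal.ofReal (C1 * |f x| ^ p1) *
            ENNReal.ofReal ((Iio (|f x| / η)).indicator (fun t => t ^ (p - p1 - 1)) t) +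
           ENNReal.ofReal (C2 * f x ^ 2) *
            ENNReal.ofReal ((Ici (|f x| / η)).indicator (fun t => t ^ (-(2 - p) - 1)) t)) := by
          refine setLIntegral_mono' measurableSet_Ioi fun t ht => ?_
          have ht : 0 < t := ht
          rw [← ENNReal.ofReal_sum_of_nonneg fun x _ => hind0 _ _ _ ht]
          refine (ENNReal.ofReal_le_ofReal (dist t ht)).trans (le_of_eq ?_)
          have c1 : ∀ x, 0 ≤ C1 * |f x| ^ p1 := fun x =>
            mul_nonneg hC1 (Real.rpow_nonneg (abs_nonneg _) _)
          have c2 : ∀ x, 0 ≤ C2 * f x ^ 2 := fun x => mul_nonneg hC2 (sq_nonneg _)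
          rw [ENNReal.ofReal_sum_of_nonneg fun x _ => add_nonneg (mul_nonneg (c1 x) (hind0 _ _ _ ht))
            (mul_nonneg (c2 x) (hind0 _ _ _ ht))]
          refine Finset.sum_congr rfl fun x _ => ?_
          rw [ENNReal.ofReal_add (mul_nonneg (c1 x) (hind0 _ _ _ ht))
            (mul_nonneg (c2 x) (hind0 _ _ _ ht)), ENNReal.ofReal_mul (c1 x), ENNReal.ofReal_mul (c2 x)]
      _ = _ := by
          rw [lintegral_finsetSum]
          · refine Finset.sum_congr rfl fun x _ => ?_
            rw [lintegral_add_left, lintegral_const_mul, lintegral_const_mul, lint_low (by linarith)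
              (by positivity)]
            · congr 1
              by_cases hx : f x = 0
              · simp [hx]
              · rw [lint_high (by linarith) (by positivity)]
            · exact (hmeas _ _ measurableSet_Ici).ennreal_ofReal
            · exact (hmeas _ _ measurableSet_Iio).ennreal_ofReal
            · exact (hmeas _ _ measurableSet_Iio).ennreal_ofReal.const_mul _
          · intro x _
            exact ((hmeas _ _ measurableSet_Iio).ennreal_ofReal.const_mul _).add
              ((hmeas _ _ measurableSet_Ici).ennreal_ofReal.const_mul _)
  have hd1 : 0 < p - p1 := by linarith
  have hd2 : 0 < 2 - p := by linarith
  have P : ∑ x, (Q f x / 2) ^ p / p ≤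
      ∑ x, (C1 / (p - p1) * η ^ (p1 - p) + C2 / (2 - p) * η ^ (2 - p)) * |f x| ^ p := by
    have nn : ∀ x, 0 ≤ C1 * |f x| ^ p1 * ((|f x| / η) ^ (p - p1) / (p - p1)) := fun x => by positivity
    have nn2 : ∀ x, 0 ≤ C2 * f x ^ 2 * ((|f x| / η) ^ (-(2 - p)) / (2 - p)) := fun x => by positivity
    have nn3 : ∀ x, 0 ≤ (Q f x / 2) ^ p / p := fun x =>
      div_nonneg (Real.rpow_nonneg (div_nonneg (hQ0 _ _) (by norm_num)) _) hpp.le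
    rw [← ENNReal.ofReal_sum_of_nonneg fun x _ => nn3 x] at L
    have e : ∀ x, (ENNReal.ofReal (C1 * |f x| ^ p1) * ENNReal.ofReal ((|f x| / η) ^ (p - p1) / (p - p1)) +
        ENNReal.ofReal (C2 * f x ^ 2) * ENNReal.ofReal ((|f x| / η) ^ (-(2 - p)) / (2 - p))) =
        ENNReal.ofReal ((C1 / (p - p1) * η ^ (p1 - p) + C2 / (2 - p) * η ^ (2 - p)) * |f x| ^ p) := by
      intro x
      rw [← ENNReal.ofReal_mul (by positivity), ← ENNReal.ofReal_mul (by positivity),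
        ← ENNReal.ofReal_add (nn x) (nn2 x)]
      congr 1
      by_cases hx : f x = 0
      · simp [hx, Real.zero_rpow hpp.ne', Real.zero_rpow (show p1 ≠ 0 by linarith)]
      · have hx' : 0 < |f x| := abs_pos.2 hx
        rw [Real.div_rpow hx'.le hη.le, Real.div_rpow hx'.le hη.le, ← sq_abs (f x), ← Real.rpow_two]
        have a1 : |f x| ^ p = |f x| ^ p1 * |f x| ^ (p - p1) := by
          rw [← Real.rpow_add hx']; congr 1; ring
        have a2 : |f x| ^ p = |f x| ^ (2:ℝ) * |f x| ^ (-(2 - p)) := by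
          rw [← Real.rpow_add hx']; congr 1; ring
        have a3 : η ^ (p1 - p) = (η ^ (p - p1))⁻¹ := by
          rw [← Real.rpow_neg hη.le]; congr 1; ring
        have a4 : η ^ (2 - p) = (η ^ (-(2 - p)))⁻¹ := by
          rw [← Real.rpow_neg hη.le]; congr 1; ring
        rw [add_mul]
        congr 1
        · rw [a1, a3]; ring
        · rw [a2, a4]; ring
    simp only [e] at L
    rw [← ENNReal.ofReal_sum_of_nonneg fun x _ => by positivity] at L
    exact (ENNReal.ofReal_le_ofReal_iff (Finset.sum_nonneg fun x _ => by positivity)).1 L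
  rw [← Finset.mul_sum, ← Finset.sum_div] at P
  have e2 : ∀ x, (Q f x / 2) ^ p = Q f x ^ p / 2 ^ p := fun x =>
    Real.div_rpow (hQ0 _ _) (by norm_num) _
  simp only [e2] at P
  rw [← Finset.sum_div, div_div, div_le_iff₀ (by positivity)] at P
  linarith

end marc


section fourier
variable {G : Type*} [AddCommGroup G] [Fintype G] {V : Type*} [Fintype V] [Nonempty V] {ι : Type*}

open scoped ComplexConjugate

noncomputable def ft (f : G → ℝ) (ψ : AddChar G ℂ) : ℂ := ∑ x, (f x : ℂ) * ψ x

noncomputable def sym (W : Finset ι) (s : ι → G) (ψ : AddChar G ℂ) : ℂ :=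
  (W.card : ℂ)⁻¹ * ∑ w ∈ W, ψ (-(s w))

lemma parseval (f : G → ℝ) : ∑ ψ : AddChar G ℂ, ‖ft f ψ‖ ^ 2 = Fintype.card G * ∑ x, f x ^ 2 := by
  classical
  have h : ((∑ ψ : AddChar G ℂ, ‖ft f ψ‖ ^ 2 : ℝ) : ℂ) = ((Fintype.card G * ∑ x, f x ^ 2 : ℝ) : ℂ) := by
    push_cast
    have e : ∀ ψ : AddChar G ℂ, (‖ft f ψ‖ : ℂ) ^ 2 = ∑ x, ∑ y, (f x : ℂ) * f y * ψ (x - y) := by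
      intro ψ
      rw [← Complex.mul_conj']
      simp only [ft, map_sum, map_mul, Complex.conj_ofReal, ← AddChar.map_neg_eq_conj]
      rw [Finset.sum_mul_sum]
      refine Finset.sum_congr rfl fun x _ => Finset.sum_congr rfl fun y _ => ?_
      rw [sub_eq_add_neg, AddChar.map_add_eq_mul]; ring
    simp only [e]
    rw [Finset.sum_comm, Finset.mul_sum]
    refine Finset.sum_congr rfl fun x _ => ?_
    rw [Finset.sum_comm]
    simp only [← Finset.mul_sum, AddChar.sum_apply_eq_ite, sub_eq_zero]
    simp; ring
  exact_mod_cast h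

lemma ft_shift (f : G → ℝ) (c : G) (ψ : AddChar G ℂ) :
    ft (fun x => f (x + c)) ψ = ψ (-c) * ft f ψ := by
  simp only [ft]
  rw [← Equiv.sum_comp (Equiv.addRight c) (fun x => (f x : ℂ) * ψ x), Finset.mul_sum]
  refine Finset.sum_congr rfl fun x _ => ?_
  simp only [Equiv.coe_addRight, AddChar.map_add_eq_mul]
  have : ψ c * ψ (-c) = 1 := by rw [← AddChar.map_add_eq_mul]; simp
  linear_combination (-(f (x+c) : ℂ) * ψ x) * this

lemma ft_sub (f g : G → ℝ) (ψ : AddChar G ℂ) :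
    ft (fun x => f x - g x) ψ = ft f ψ - ft g ψ := by
  simp [ft, sub_mul]

lemma ft_avg {κ : Type*} (S : Finset κ) (c : ℝ) (F : κ → G → ℝ) (ψ : AddChar G ℂ) :
    ft (fun x => c * ∑ k ∈ S, F k x) ψ = c * ∑ k ∈ S, ft (F k) ψ := by
  simp only [ft]
  rw [Finset.sum_comm, Finset.mul_sum]
  refine Finset.sum_congr rfl fun x _ => ?_
  push_cast
  rw [← Finset.sum_mul]; ring

lemma ft_av (W : Finset ι) (s : ι → G) (f : G → ℝ) (ψ : AddChar G ℂ) :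
    ft (av W s f) ψ = sym W s ψ * ft f ψ := by
  have := ft_avg W (W.card : ℝ)⁻¹ (fun w x => f (x + s w)) ψ
  change ft (av W s f) ψ = _ at this
  rw [this]
  simp only [ft_shift, ← Finset.sum_mul, sym]
  push_cast; ring

noncomputable def bet (v : ℕ → V → G) (i : ℕ) (ψ : AddChar G ℂ) : ℂ := sym Finset.univ (v i) ψ

noncomputable def tt (v : ℕ → V → G) (j : ℕ) (ψ : AddChar G ℂ) : ℝ :=
  ∏ i ∈ Finset.range j, ‖bet v i ψ‖ ^ 2

lemma ft_itav (v : ℕ → V → G) (f : G → ℝ) (j : ℕ) (ψ : AddChar G ℂ) :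
    ft (itav v f j) ψ = (∏ i ∈ Finset.range j, bet v i ψ) * ft f ψ := by
  induction j with
  | zero => simp [itav]
  | succ j ih =>
    rw [itav, ft_av, ih, Finset.prod_range_succ, bet]; ring

lemma conj_bet (v : ℕ → V → G) (i : ℕ) (ψ : AddChar G ℂ) :
    conj (bet v i ψ) = (Fintype.card V : ℂ)⁻¹ * ∑ a, ψ (v i a) := by
  simp only [bet, sym, map_mul, map_inv₀, map_sum, ← AddChar.map_neg_eq_conj, neg_neg]
  simp

lemma char_sum {κ : Type*} (S : Finset κ) (g : κ → G) (ψ : AddChar G ℂ) :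
    ψ (∑ i ∈ S, g i) = ∏ i ∈ S, ψ (g i) := by
  classical
  induction S using Finset.induction_on with
  | empty => simp
  | insert a S ha ih => rw [Finset.sum_insert ha, Finset.prod_insert ha, AddChar.map_add_eq_mul, ih]

lemma ft_Tav (v : ℕ → V → G) (J j : ℕ) (hj : j ≤ J) (f : G → ℝ) (ψ : AddChar G ℂ) :
    ft (Tav v J j f) ψ = tt v j ψ * ft f ψ := by
  classical
  have := ft_avg Finset.univ (Fintype.card (Fin J → V) : ℝ)⁻¹
    (fun e x => itav v f j (posn v J j (x, e))) ψ
  change ft (Tav v J j f) ψ = _ at this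
  rw [this]
  have h1 : ∀ e : Fin J → V, ft (fun x => itav v f j (posn v J j (x, e))) ψ =
      (∏ i : Fin J, if i.1 < j then ψ (v i (e i)) else 1) * ft (itav v f j) ψ := by
    intro e
    have := ft_shift (itav v f j) (-∑ i : Fin J, if i.1 < j then v i (e i) else 0) ψ
    simp only [← sub_eq_add_neg, neg_neg] at this
    simp only [posn]
    rw [this, char_sum]
    congr 1
    refine Finset.prod_congr rfl fun i _ => ?_
    split_ifs <;> simp
  simp only [h1, ← Finset.sum_mul]
  rw [ft_itav]
  have h2 : ∑ e : Fin J → V, ∏ i : Fin J, (if i.1 < j then ψ (v i (e i)) else 1) =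
      ∏ i : Fin J, ∑ a : V, (if i.1 < j then ψ (v i a) else 1) := by
    rw [Finset.prod_univ_sum]
    simp
  have hV : (Fintype.card V : ℂ) ≠ 0 := by simp
  have h3 : ((Fintype.card (Fin J → V) : ℝ)⁻¹ : ℂ) *
      ∏ i : Fin J, ∑ a : V, (if i.1 < j then ψ (v i a) else 1) =
      ∏ i ∈ Finset.range j, conj (bet v i ψ) := by
    have e1 : ((Fintype.card (Fin J → V) : ℝ)⁻¹ : ℂ) = ∏ i : Fin J, (Fintype.card V : ℂ)⁻¹ := by
      simp
    rw [e1, ← Finset.prod_mul_distrib]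
    have e2 : ∀ i : Fin J, (Fintype.card V : ℂ)⁻¹ * ∑ a : V, (if i.1 < j then ψ (v i a) else 1) =
        if i.1 < j then conj (bet v i ψ) else 1 := by
      intro i
      rw [conj_bet]
      split_ifs
      · rfl
      · simp
    simp only [e2]
    rw [Fin.prod_univ_eq_prod_range (fun i => if i < j then conj (bet v i ψ) else 1) J]
    rw [← Finset.prod_subset (Finset.range_mono hj) (f := fun i => if i < j then conj (bet v i ψ) else 1)]
    · refine Finset.prod_congr rfl fun i hi => ?_
      simp [Finset.mem_range.1 hi]
    · intro i _ hi
      simp at hi; simp [hi]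
  rw [h2]
  push_cast at h3 ⊢
  rw [← mul_assoc, h3, tt, ← mul_assoc, ← Finset.prod_mul_distrib]
  congr 1
  push_cast
  refine Finset.prod_congr rfl fun i _ => ?_
  rw [← Complex.mul_conj', mul_comm]

noncomputable def dl (v : ℕ → V → G) (J j : ℕ) (ψ : AddChar G ℂ) : ℝ :=
  if j < J then tt v j ψ - tt v (j + 1) ψ else tt v j ψ

lemma ft_Dop (v : ℕ → V → G) (J j : ℕ) (hj : j ≤ J) (f : G → ℝ) (ψ : AddChar G ℂ) :
    ft (Dop v J j f) ψ = dl v J j ψ * ft f ψ := by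
  rcases hj.lt_or_eq with h | h
  · have : Dop v J j f = fun x => Tav v J j f x - Tav v J (j+1) f x := by
      ext x; simp [Dop, h]
    rw [this, ft_sub, ft_Tav _ _ _ hj, ft_Tav _ _ _ h, dl, if_pos h]
    push_cast; ring
  · have : Dop v J j f = Tav v J j f := by
      ext x; simp [Dop, h]
    rw [this, ft_Tav _ _ _ hj, dl, if_neg (by omega)]

lemma norm_sym_le (W : Finset ι) (s : ι → G) (ψ : AddChar G ℂ) : ‖sym W s ψ‖ ≤ 1 := by
  rw [sym, norm_mul, norm_inv, Complex.norm_natCast]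
  rcases W.eq_empty_or_nonempty with h | h
  · simp [h]
  have : 0 < (W.card : ℝ) := by exact_mod_cast h.card_pos
  rw [inv_mul_le_one₀ this]
  refine (norm_sum_le _ _).trans ?_
  simp

lemma tt_nonneg (v : ℕ → V → G) (j : ℕ) (ψ : AddChar G ℂ) : 0 ≤ tt v j ψ :=
  Finset.prod_nonneg fun _ _ => by positivity

lemma tt_zero (v : ℕ → V → G) (ψ : AddChar G ℂ) : tt v 0 ψ = 1 := by simp [tt]

lemma tt_succ_le (v : ℕ → V → G) (j : ℕ) (ψ : AddChar G ℂ) : tt v (j + 1) ψ ≤ tt v j ψ := by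
  rw [tt, Finset.prod_range_succ]
  refine mul_le_of_le_one_right (tt_nonneg v j ψ) ?_
  exact pow_le_one₀ (norm_nonneg _) (norm_sym_le _ _ _)

lemma dl_nonneg (v : ℕ → V → G) (J j : ℕ) (ψ : AddChar G ℂ) : 0 ≤ dl v J j ψ := by
  rw [dl]; split_ifs
  · linarith [tt_succ_le v j ψ]
  · exact tt_nonneg _ _ _

lemma dl_le (v : ℕ → V → G) (J j : ℕ) (ψ : AddChar G ℂ) : dl v J j ψ ≤ tt v j ψ := by
  rw [dl]; split_ifs
  · linarith [tt_nonneg v (j+1) ψ]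
  · exact le_rfl

lemma sum_dl (v : ℕ → V → G) (J : ℕ) (ψ : AddChar G ℂ) :
    ∑ j ∈ Finset.range (J + 1), dl v J j ψ = 1 := by
  rw [Finset.sum_range_succ]
  have : ∑ j ∈ Finset.range J, dl v J j ψ = ∑ j ∈ Finset.range J, (tt v j ψ - tt v (j+1) ψ) :=
    Finset.sum_congr rfl fun j hj => by rw [dl, if_pos (Finset.mem_range.1 hj)]
  rw [this, Finset.sum_range_sub', tt_zero]
  simp [dl]

lemma l2_bound {κ : Type*} (S : Finset κ) (g : κ → G → ℝ) (f : G → ℝ) (K : ℝ)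
    (h : ∀ ψ : AddChar G ℂ, ∑ j ∈ S, ‖ft (g j) ψ‖ ^ 2 ≤ K * ‖ft f ψ‖ ^ 2) :
    ∑ x, ∑ j ∈ S, g j x ^ 2 ≤ K * ∑ x, f x ^ 2 := by
  have h1 := Finset.sum_le_sum fun ψ (_ : ψ ∈ Finset.univ) => h ψ
  rw [Finset.sum_comm, ← Finset.mul_sum, parseval] at h1
  simp only [parseval, ← Finset.mul_sum] at h1
  rw [Finset.sum_comm]
  have : (0:ℝ) < Fintype.card G := by exact_mod_cast Fintype.card_pos
  nlinarith

/-- Hypotheses on the symbols. -/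
def SymHyp (v : ℕ → V → G) (J : ℕ) (W : ℕ → Finset ι) (s : ι → G) : Prop :=
  ∀ ψ : AddChar G ℂ, ∃ X : ℝ, 0 ≤ X ∧ ∀ j, 1 ≤ j → j ≤ J →
    ‖sym (W j) s ψ‖ ^ 2 * (1 + 4 ^ j * X / 32) ≤ 1 ∧ ‖1 - sym (W j) s ψ‖ ≤ 4 ^ j * X ∧
    tt v j ψ * (1 + 4 ^ j * X / 32) ≤ 1 ∧ 1 - tt v j ψ ≤ 4 ^ j * X

theorem high_l2 (v : ℕ → V → G) (J : ℕ) (W : ℕ → Finset ι) (s : ι → G)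
    (H : SymHyp v J W s) (m : ℕ) (f : G → ℝ) :
    ∑ x, ∑ i ∈ (Finset.range (J + 1)).filter (fun i => i + 1 + m ≤ J),
      av (W (i + 1 + m)) s (Dop v J i f) x ^ 2 ≤ 64 * (4⁻¹) ^ m * ∑ x, f x ^ 2 := by
  refine l2_bound _ (fun i => av (W (i + 1 + m)) s (Dop v J i f)) f _ fun ψ => ?_
  obtain ⟨X, hX, h⟩ := H ψ
  have key : ∀ i ∈ (Finset.range (J + 1)).filter (fun i => i + 1 + m ≤ J),
      ‖ft (av (W (i + 1 + m)) s (Dop v J i f)) ψ‖ ^ 2 ≤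
        dl v J i ψ * (64 * (4⁻¹) ^ m * ‖ft f ψ‖ ^ 2) := by
    intro i hi
    simp only [Finset.mem_filter, Finset.mem_range] at hi
    rw [ft_av, ft_Dop _ _ _ (by omega), norm_mul, norm_mul, Complex.norm_real,
      Real.norm_of_nonneg (dl_nonneg _ _ _ _)]
    have h1 := (h (i + 1 + m) (by omega) hi.2).1
    obtain ⟨-, -, -, h2⟩ := h (i + 1) (by omega) (by omega)
    have hd : dl v J i ψ ≤ 4 ^ (i+1) * X := by
      rw [dl, if_pos (by omega)]
      have : tt v i ψ ≤ 1 := by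
        have h0 := sum_dl v J ψ
        clear h0
        induction i with
        | zero => rw [tt_zero]
        | succ i _ => exact Finset.prod_le_one (fun _ _ => by positivity) fun i _ => pow_le_one₀ (norm_nonneg _) (norm_sym_le _ _ _)
      linarith
    have h4 : ‖sym (W (i + 1 + m)) s ψ‖ ^ 2 * dl v J i ψ ≤ 64 * (4⁻¹) ^ m := by
      have a1 : ‖sym (W (i + 1 + m)) s ψ‖ ^ 2 * (4 ^ (i + 1) * X) * 4 ^ m ≤ 32 := by
        have : (4:ℝ) ^ (i + 1 + m) = 4 ^ (i+1) * 4 ^ m := pow_add _ _ _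
        rw [this] at h1
        nlinarith [sq_nonneg ‖sym (W (i + 1 + m)) s ψ‖]
      have a2 : ‖sym (W (i + 1 + m)) s ψ‖ ^ 2 * dl v J i ψ ≤ ‖sym (W (i + 1 + m)) s ψ‖ ^ 2 * (4 ^ (i + 1) * X) := by
        gcongr
      rw [inv_pow, ← div_eq_mul_inv, le_div_iff₀ (by positivity)]
      calc _ ≤ ‖sym (W (i + 1 + m)) s ψ‖ ^ 2 * (4 ^ (i + 1) * X) * 4 ^ m := by gcongr
        _ ≤ _ := by linarith
    calc (‖sym (W (i + 1 + m)) s ψ‖ * (dl v J i ψ * ‖ft f ψ‖)) ^ 2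
        = dl v J i ψ * ((‖sym (W (i + 1 + m)) s ψ‖ ^ 2 * dl v J i ψ) * ‖ft f ψ‖ ^ 2) := by ring
      _ ≤ _ := by
        have := dl_nonneg v J i ψ
        gcongr
  refine (Finset.sum_le_sum key).trans ?_
  rw [← Finset.sum_mul]
  refine mul_le_of_le_one_left (by positivity) ?_
  rw [← sum_dl v J ψ]
  exact Finset.sum_le_sum_of_subset_of_nonneg (Finset.filter_subset _ _) fun _ _ _ => dl_nonneg _ _ _ _

theorem low_l2 (v : ℕ → V → G) (J : ℕ) (W : ℕ → Finset ι) (s : ι → G)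
    (H : SymHyp v J W s) (m : ℕ) (f : G → ℝ) :
    ∑ x, ∑ j ∈ (Finset.Icc 1 J).filter (fun j => j + m ≤ J),
      (av (W j) s (Dop v J (j + m) f) x - Dop v J (j + m) f x) ^ 2 ≤ 64 * (4⁻¹) ^ m * ∑ x, f x ^ 2 := by
  refine l2_bound _ (fun j x => av (W j) s (Dop v J (j + m) f) x - Dop v J (j + m) f x) f _ fun ψ => ?_
  obtain ⟨X, hX, h⟩ := H ψ
  have key : ∀ j ∈ (Finset.Icc 1 J).filter (fun j => j + m ≤ J),
      ‖ft (fun x => av (W j) s (Dop v J (j + m) f) x - Dop v J (j + m) f x) ψ‖ ^ 2 ≤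
        dl v J (j + m) ψ * (64 * (4⁻¹) ^ m * ‖ft f ψ‖ ^ 2) := by
    intro j hj
    simp only [Finset.mem_filter, Finset.mem_Icc] at hj
    rw [ft_sub (av (W j) s (Dop v J (j + m) f)), ft_av, ft_Dop _ _ _ (by omega)]
    obtain ⟨-, h1, -, -⟩ := h j (by omega) (by omega)
    obtain ⟨-, -, h2, -⟩ := h (j + m) (by omega) (by omega)
    have d0 := dl_nonneg v J (j + m) ψ
    have d1 := dl_le v J (j + m) ψ
    have e : sym (W j) s ψ * (dl v J (j + m) ψ * ft f ψ) - dl v J (j + m) ψ * ft f ψ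
        = -((1 - sym (W j) s ψ) * (dl v J (j + m) ψ * ft f ψ)) := by ring
    rw [e, norm_neg, norm_mul, norm_mul, Complex.norm_real, Real.norm_of_nonneg d0]
    set N := ‖1 - sym (W j) s ψ‖
    have hN0 : 0 ≤ N := norm_nonneg _
    have hN2 : N ≤ 2 := by
      refine (norm_sub_le _ _).trans ?_
      have := norm_sym_le (W j) s ψ
      simp; linarith
    have h4 : N ^ 2 * dl v J (j + m) ψ ≤ 64 * (4⁻¹) ^ m := by
      rw [inv_pow, ← div_eq_mul_inv, le_div_iff₀ (by positivity)]
      have a1 : tt v (j + m) ψ * (4 ^ j * X) * 4 ^ m ≤ 32 := by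
        have : (4:ℝ) ^ (j + m) = 4 ^ j * 4 ^ m := pow_add _ _ _
        rw [this] at h2
        nlinarith [tt_nonneg v (j + m) ψ]
      calc N ^ 2 * dl v J (j + m) ψ * 4 ^ m ≤ (2 * (4 ^ j * X)) * tt v (j + m) ψ * 4 ^ m := by
            have : N ^ 2 ≤ 2 * (4 ^ j * X) := by nlinarith
            gcongr
        _ ≤ _ := by linarith
    calc (N * (dl v J (j + m) ψ * ‖ft f ψ‖)) ^ 2
        = dl v J (j + m) ψ * ((N ^ 2 * dl v J (j + m) ψ) * ‖ft f ψ‖ ^ 2) := by ring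
      _ ≤ _ := by gcongr
  refine (Finset.sum_le_sum key).trans ?_
  rw [← Finset.sum_mul]
  refine mul_le_of_le_one_left (by positivity) ?_
  rw [← sum_dl v J ψ]
  have : ∑ j ∈ (Finset.Icc 1 J).filter (fun j => j + m ≤ J), dl v J (j + m) ψ =
      ∑ i ∈ ((Finset.Icc 1 J).filter (fun j => j + m ≤ J)).map (addRightEmbedding m), dl v J i ψ := by
    simp
  rw [this]
  refine Finset.sum_le_sum_of_subset_of_nonneg ?_ fun _ _ _ => dl_nonneg _ _ _ _
  intro i hi
  simp only [Finset.mem_map, Finset.mem_filter, Finset.mem_Icc, addRightEmbedding_apply] at hi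
  obtain ⟨j, hj, rfl⟩ := hi
  simp; omega

end fourier


section boot
variable {G : Type*} [AddCommGroup G] [Fintype G] {V : Type*} [Fintype V] [Nonempty V] {ι : Type*}

lemma add_of_sub (T : (G → ℝ) → G → ℝ)
    (h : ∀ f g x, T (fun y => f y - g y) x = T f x - T g x) (f g : G → ℝ) (x : G) :
    T (fun y => f y + g y) x = T f x + T g x := by
  have h0 : T (fun _ => 0) x = 0 := by
    have := h (fun _ => 0) (fun _ => 0) x
    simp only [sub_self] at this; exact this
  have h1 := h (fun _ => 0) g x
  have h2 := h f (fun y => 0 - g y) x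
  rw [h1, h0] at h2
  have e : (fun y => f y + g y) = fun y => f y - (0 - g y) := by ext y; ring
  rw [e, h2]; ring

lemma l2_tri {κ : Type*} (S : Finset κ) (a b : κ → ℝ) :
    √(∑ i ∈ S, (a i + b i) ^ 2) ≤ √(∑ i ∈ S, a i ^ 2) + √(∑ i ∈ S, b i ^ 2) := by
  have ha : 0 ≤ ∑ i ∈ S, a i ^ 2 := Finset.sum_nonneg fun _ _ => sq_nonneg _
  have hb : 0 ≤ ∑ i ∈ S, b i ^ 2 := Finset.sum_nonneg fun _ _ => sq_nonneg _
  refine Real.sqrt_le_iff.2 ⟨by positivity, ?_⟩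
  have h := Real.sum_mul_le_sqrt_mul_sqrt S a b
  have e : ∑ i ∈ S, (a i + b i) ^ 2 = ∑ i ∈ S, a i ^ 2 + 2 * ∑ i ∈ S, a i * b i + ∑ i ∈ S, b i ^ 2 := by
    rw [Finset.mul_sum, ← Finset.sum_add_distrib, ← Finset.sum_add_distrib]
    exact Finset.sum_congr rfl fun _ _ => by ring
  rw [e, add_sq, Real.sq_sqrt ha, Real.sq_sqrt hb]; linarith

variable (v : ℕ → V → G) (J : ℕ) (W : ℕ → Finset ι) (s : ι → G)

noncomputable def Qh (m : ℕ) (f : G → ℝ) (x : G) : ℝ :=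
  √(∑ i ∈ (Finset.range (J + 1)).filter (fun i => i + 1 + m ≤ J),
      av (W (i + 1 + m)) s (Dop v J i f) x ^ 2)

noncomputable def Ql (m : ℕ) (f : G → ℝ) (x : G) : ℝ :=
  √(∑ j ∈ (Finset.Icc 1 J).filter (fun j => j + m ≤ J),
      (av (W j) s (Dop v J (j + m) f) x - Dop v J (j + m) f x) ^ 2)

lemma Qh_sub (m : ℕ) (f g : G → ℝ) (x : G) :
    Qh v J W s m (fun y => f y + g y) x ≤ Qh v J W s m f x + Qh v J W s m g x := by
  have e : ∀ i, av (W (i + 1 + m)) s (Dop v J i (fun y => f y + g y)) x =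
      av (W (i + 1 + m)) s (Dop v J i f) x + av (W (i + 1 + m)) s (Dop v J i g) x := by
    intro i
    refine add_of_sub (fun f => av (W (i + 1 + m)) s (Dop v J i f)) (fun f g x => ?_) f g x
    have : Dop v J i (fun y => f y - g y) = fun y => Dop v J i f y - Dop v J i g y := by
      ext y; exact Dop_sub v J i f g y
    simp only [this, av_sub]
  simp only [Qh, e]
  exact l2_tri _ _ _

lemma Ql_sub (m : ℕ) (f g : G → ℝ) (x : G) :
    Ql v J W s m (fun y => f y + g y) x ≤ Ql v J W s m f x + Ql v J W s m g x := by
  have e : ∀ j, av (W j) s (Dop v J (j + m) (fun y => f y + g y)) x - Dop v J (j + m) (fun y => f y + g y) x =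
      (av (W j) s (Dop v J (j + m) f) x - Dop v J (j + m) f x) +
      (av (W j) s (Dop v J (j + m) g) x - Dop v J (j + m) g x) := by
    intro j
    refine add_of_sub (fun f x => av (W j) s (Dop v J (j + m) f) x - Dop v J (j + m) f x) (fun f g x => ?_) f g x
    have : Dop v J (j + m) (fun y => f y - g y) = fun y => Dop v J (j + m) f y - Dop v J (j + m) g y := by
      ext y; exact Dop_sub v J (j + m) f g y
    simp only [this, av_sub]; ring
  simp only [Ql, e]
  exact l2_tri _ _ _

lemma Qh_two (H : SymHyp v J W s) (m : ℕ) (f : G → ℝ) :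
    ∑ x, Qh v J W s m f x ^ 2 ≤ 64 * (4⁻¹) ^ m * ∑ x, f x ^ 2 := by
  refine le_trans (le_of_eq ?_) (high_l2 v J W s H m f)
  refine Finset.sum_congr rfl fun x _ => Real.sq_sqrt (Finset.sum_nonneg fun _ _ => sq_nonneg _)

lemma Ql_two (H : SymHyp v J W s) (m : ℕ) (f : G → ℝ) :
    ∑ x, Ql v J W s m f x ^ 2 ≤ 64 * (4⁻¹) ^ m * ∑ x, f x ^ 2 := by
  refine le_trans (le_of_eq ?_) (low_l2 v J W s H m f)
  refine Finset.sum_congr rfl fun x _ => Real.sq_sqrt (Finset.sum_nonneg fun _ _ => sq_nonneg _)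

/-- constant of the square function estimate -/
noncomputable def Dc (p : ℝ) : ℝ := 4 * (2 / (p * (p - 1)) + (p / (p - 1)) ^ p)

lemma Dc_nonneg {p : ℝ} (hp : 1 < p) : 0 ≤ Dc p := by
  have : 0 < p - 1 := by linarith
  unfold Dc; positivity

/-- maximal bound for this configuration -/
def MaxB (p B : ℝ) : Prop := ∀ f : G → ℝ, (∀ x, 0 ≤ f x) → ∀ k : G → ℕ,
  (∀ x, 1 ≤ k x ∧ k x ≤ J) → ∑ x, av (W (k x)) s f x ^ p ≤ B * ∑ x, f x ^ p

lemma sqrt_rpow' {a q : ℝ} (ha : 0 ≤ a) : (√a) ^ q = a ^ (q / 2) := by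
  rw [Real.sqrt_eq_rpow, ← Real.rpow_mul ha]; congr 1; ring

lemma Qh_p1 (hW : ∀ j, (W j).Nonempty) {p0 p1 B : ℝ} (hp0 : 1 < p0) (hB : 0 ≤ B)
    (hp1 : p1 = 2 * (p0 / (1 + p0))) (H : MaxB J W s p0 B) (m : ℕ) (f : G → ℝ) :
    ∑ x, Qh v J W s m f x ^ p1 ≤ (2 * (B + 2) * Dc p1) * ∑ x, |f x| ^ p1 := by
  have h1 : 1 < p1 := by
    rw [hp1, ← mul_div_assoc, lt_div_iff₀ (by linarith)]; linarith
  have h2 : p1 < 2 := by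
    rw [hp1, ← mul_div_assoc, div_lt_iff₀ (by linarith)]; linarith
  have h3 : p1 / 2 = p0 / (1 + p0) := by rw [hp1]; ring
  have hr : 0 ≤ p0 / (1 + p0) := by positivity
  have key := vec_bound (fun i => W (i + 1 + m)) (fun i => hW _) s
    ((Finset.range (J + 1)).filter (fun i => i + 1 + m ≤ J)) hp0 (B := B)
    (fun f hf k hk => H f hf (fun x => k x + 1 + m) (fun x => by
      have := hk x; simp at this; omega)) (fun i => Dop v J i f)
  have d := Dop_sq v J h1 h2 f
  rw [h3] at d
  calc ∑ x, Qh v J W s m f x ^ p1 = _ := by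
        refine Finset.sum_congr rfl fun x _ => ?_
        rw [Qh, sqrt_rpow' (Finset.sum_nonneg fun _ _ => sq_nonneg _), h3]
    _ ≤ _ := key
    _ ≤ (B + 1) * ∑ x, (∑ j ∈ Finset.range (J + 1), Dop v J j f x ^ 2) ^ (p0 / (1 + p0)) := by
        gcongr with x _
        exact Finset.filter_subset _ _
    _ ≤ (B + 1) * (Dc p1 * ∑ x, |f x| ^ p1) := by gcongr; exact d
    _ ≤ _ := by
        rw [← mul_assoc]
        have := Dc_nonneg h1
        have : 0 ≤ ∑ x, |f x| ^ p1 := Finset.sum_nonneg fun _ _ => by positivity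
        gcongr
        linarith

lemma Ql_p1 (hW : ∀ j, (W j).Nonempty) {p0 p1 B : ℝ} (hp0 : 1 < p0) (hB : 0 ≤ B)
    (hp1 : p1 = 2 * (p0 / (1 + p0))) (H : MaxB J W s p0 B) (m : ℕ) (f : G → ℝ) :
    ∑ x, Ql v J W s m f x ^ p1 ≤ (2 * (B + 2) * Dc p1) * ∑ x, |f x| ^ p1 := by
  have h1 : 1 < p1 := by
    rw [hp1, ← mul_div_assoc, lt_div_iff₀ (by linarith)]; linarith
  have h2 : p1 < 2 := by
    rw [hp1, ← mul_div_assoc, div_lt_iff₀ (by linarith)]; linarith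
  have h3 : p1 / 2 = p0 / (1 + p0) := by rw [hp1]; ring
  have hr : 0 ≤ p0 / (1 + p0) := by positivity
  have hr1 : p0 / (1 + p0) ≤ 1 := by linarith
  set r := p0 / (1 + p0) with hrdef
  set I := (Finset.Icc 1 J).filter (fun j => j + m ≤ J) with hI
  have key := vec_bound W hW s I hp0 (B := B)
    (fun f hf k hk => H f hf k (fun x => by
      have := hk x; simp [hI] at this; omega)) (fun i => Dop v J (i + m) f)
  have d := Dop_sq v J h1 h2 f
  rw [h3] at d
  have sub : ∀ x, ∑ j ∈ I, Dop v J (j + m) f x ^ 2 ≤ ∑ j ∈ Finset.range (J + 1), Dop v J j f x ^ 2 := by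
    intro x
    have : ∑ j ∈ I, Dop v J (j + m) f x ^ 2 = ∑ i ∈ I.map (addRightEmbedding m), Dop v J i f x ^ 2 := by
      simp
    rw [this]
    refine Finset.sum_le_sum_of_subset_of_nonneg ?_ fun _ _ _ => sq_nonneg _
    intro i hi
    simp only [hI, Finset.mem_map, Finset.mem_filter, Finset.mem_Icc, addRightEmbedding_apply] at hi
    obtain ⟨j, hj, rfl⟩ := hi
    simp; omega
  have nn : ∀ x, 0 ≤ ∑ j ∈ I, Dop v J (j + m) f x ^ 2 := fun x => Finset.sum_nonneg fun _ _ => sq_nonneg _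
  have nn2 : ∀ x, 0 ≤ ∑ j ∈ I, av (W j) s (Dop v J (j + m) f) x ^ 2 := fun x => Finset.sum_nonneg fun _ _ => sq_nonneg _
  have d2 : ∑ x, (∑ j ∈ I, Dop v J (j + m) f x ^ 2) ^ r ≤ Dc p1 * ∑ x, |f x| ^ p1 := by
    refine le_trans ?_ d
    gcongr with x _
    exact sub x
  calc ∑ x, Ql v J W s m f x ^ p1 ≤ ∑ x, 2 * ((∑ j ∈ I, av (W j) s (Dop v J (j + m) f) x ^ 2) ^ r +
        (∑ j ∈ I, Dop v J (j + m) f x ^ 2) ^ r) := by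
        refine Finset.sum_le_sum fun x _ => ?_
        rw [Ql, sqrt_rpow' (Finset.sum_nonneg fun _ _ => sq_nonneg _), h3]
        have e : ∑ j ∈ I, (av (W j) s (Dop v J (j + m) f) x - Dop v J (j + m) f x) ^ 2 ≤
            2 * (∑ j ∈ I, av (W j) s (Dop v J (j + m) f) x ^ 2 + ∑ j ∈ I, Dop v J (j + m) f x ^ 2) := by
          rw [← Finset.sum_add_distrib, Finset.mul_sum]
          refine Finset.sum_le_sum fun j _ => ?_
          nlinarith [sq_nonneg (av (W j) s (Dop v J (j + m) f) x + Dop v J (j + m) f x)]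
        refine (Real.rpow_le_rpow (Finset.sum_nonneg fun _ _ => sq_nonneg _) e hr).trans ?_
        rw [Real.mul_rpow (by norm_num) (add_nonneg (nn2 x) (nn x))]
        have t1 : (2:ℝ) ^ r ≤ 2 := by
          calc (2:ℝ) ^ r ≤ 2 ^ (1:ℝ) := Real.rpow_le_rpow_of_exponent_le (by norm_num) hr1
            _ = 2 := by simp
        have t2 := Real.rpow_add_le_add_rpow (nn2 x) (nn x) hr hr1
        have := Real.rpow_nonneg (add_nonneg (nn2 x) (nn x)) r
        gcongr
    _ = 2 * (∑ x, (∑ j ∈ I, av (W j) s (Dop v J (j + m) f) x ^ 2) ^ r +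
        ∑ x, (∑ j ∈ I, Dop v J (j + m) f x ^ 2) ^ r) := by
        rw [← Finset.mul_sum, Finset.sum_add_distrib]
    _ ≤ 2 * ((B + 1) * (Dc p1 * ∑ x, |f x| ^ p1) + Dc p1 * ∑ x, |f x| ^ p1) := by
        gcongr
        refine key.trans ?_
        gcongr
    _ = _ := by ring

lemma marc_const {p1 p C1 : ℝ} (hp1 : 1 < p1) (hp : p1 < p) (hp2 : p < 2) (m : ℕ) :
    2 ^ p * p * (C1 / (p - p1) * ((2:ℝ) ^ m) ^ (p1 - p) + (64 * (4⁻¹) ^ m) / (2 - p) * ((2:ℝ) ^ m) ^ (2 - p)) ≤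
    2 ^ p * p * (C1 / (p - p1) + 64 / (2 - p)) * ((2:ℝ) ^ (p1 - p)) ^ m := by
  have e1 : ((2:ℝ) ^ m) ^ (p1 - p) = ((2:ℝ) ^ (p1 - p)) ^ m := by
    rw [← Real.rpow_natCast, ← Real.rpow_natCast, ← Real.rpow_mul (by norm_num), ← Real.rpow_mul (by norm_num), mul_comm]
  have e2 : (4⁻¹ : ℝ) ^ m * ((2:ℝ) ^ m) ^ (2 - p) ≤ ((2:ℝ) ^ (p1 - p)) ^ m := by
    have : (4⁻¹ : ℝ) ^ m = (2:ℝ) ^ (-2 * m : ℝ) := by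
      rw [show (4⁻¹ : ℝ) = (2:ℝ) ^ (-2:ℝ) by
        rw [Real.rpow_neg (by norm_num)]; norm_num]
      rw [← Real.rpow_natCast, ← Real.rpow_mul (by norm_num)]
    rw [this, ← e1, ← Real.rpow_natCast, ← Real.rpow_mul (by norm_num), ← Real.rpow_mul (by norm_num),
      ← Real.rpow_add (by norm_num)]
    refine Real.rpow_le_rpow_of_exponent_le (by norm_num) ?_
    have : (0:ℝ) ≤ m := by positivity
    nlinarith
  rw [mul_assoc (2 ^ p * p)]
  have : 0 < 2 - p := by linarith
  have : 0 < p := by linarith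
  gcongr
  rw [e1, add_mul]
  refine add_le_add le_rfl ?_
  calc 64 * (4⁻¹:ℝ) ^ m / (2 - p) * ((2:ℝ) ^ m) ^ (2 - p) = 64 / (2 - p) * ((4⁻¹ : ℝ) ^ m * ((2:ℝ) ^ m) ^ (2 - p)) := by ring
    _ ≤ _ := by gcongr

lemma Q_p (hW : ∀ j, (W j).Nonempty) (HS : SymHyp v J W s) {p0 p1 p B : ℝ} (hp0 : 1 < p0) (hB : 0 ≤ B)
    (hp1 : p1 = 2 * (p0 / (1 + p0))) (hp : p1 < p) (hp2 : p < 2) (H : MaxB J W s p0 B) (m : ℕ) (f : G → ℝ) :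
    ∑ x, Qh v J W s m f x ^ p ≤ 2 ^ p * p * ((2 * (B + 2) * Dc p1) / (p - p1) + 64 / (2 - p)) *
        ((2:ℝ) ^ (p1 - p)) ^ m * ∑ x, |f x| ^ p ∧
    ∑ x, Ql v J W s m f x ^ p ≤ 2 ^ p * p * ((2 * (B + 2) * Dc p1) / (p - p1) + 64 / (2 - p)) *
        ((2:ℝ) ^ (p1 - p)) ^ m * ∑ x, |f x| ^ p := by
  have h1 : 1 < p1 := by
    rw [hp1, ← mul_div_assoc, lt_div_iff₀ (by linarith)]; linarith
  have hD := Dc_nonneg h1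
  have hF : 0 ≤ ∑ x, |f x| ^ p := Finset.sum_nonneg fun _ _ => by positivity
  constructor
  · refine (marcin h1 hp hp2 (C1 := 2 * (B + 2) * Dc p1) (C2 := 64 * (4⁻¹) ^ m) (η := 2 ^ m)
      (by positivity) (by positivity) (by positivity) (Qh v J W s m) (fun _ _ => Real.sqrt_nonneg _)
      (Qh_sub v J W s m) (Qh_p1 v J W s hW hp0 hB hp1 H m) (Qh_two v J W s HS m) f).trans ?_
    exact mul_le_mul_of_nonneg_right (marc_const h1 hp hp2 m) hF
  · refine (marcin h1 hp hp2 (C1 := 2 * (B + 2) * Dc p1) (C2 := 64 * (4⁻¹) ^ m) (η := 2 ^ m)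
      (by positivity) (by positivity) (by positivity) (Ql v J W s m) (fun _ _ => Real.sqrt_nonneg _)
      (Ql_sub v J W s m) (Ql_p1 v J W s hW hp0 hB hp1 H m) (Ql_two v J W s HS m) f).trans ?_
    exact mul_le_mul_of_nonneg_right (marc_const h1 hp hp2 m) hF

end boot


section assem
variable {G : Type*} [AddCommGroup G] [Fintype G] {V : Type*} [Fintype V] [Nonempty V] {ι : Type*}

lemma lp_sum {p : ℝ} (hp : 1 ≤ p) (b : ℕ → G → ℝ) (hb : ∀ m x, 0 ≤ b m x) (n : ℕ) :
    (∑ x, (∑ m ∈ Finset.range n, b m x) ^ p) ^ (1 / p) ≤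
      ∑ m ∈ Finset.range n, (∑ x, b m x ^ p) ^ (1 / p) := by
  induction n with
  | zero =>
    have : p ≠ 0 := by linarith
    simp [Real.zero_rpow this, Real.zero_rpow (inv_ne_zero this)]
  | succ n ih =>
    simp only [Finset.sum_range_succ]
    refine (Real.Lp_add_le_of_nonneg Finset.univ hp (fun x _ => Finset.sum_nonneg fun m _ => hb m x)
      (fun x _ => hb n x)).trans ?_
    linarith

lemma lp_geom {p K θ F : ℝ} (hp : 1 < p) (hK : 0 ≤ K) (hF : 0 ≤ F) (hθ : 0 < θ) (hθ1 : θ < 1)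
    (b : ℕ → G → ℝ) (hb : ∀ m x, 0 ≤ b m x) (h : ∀ m, ∑ x, b m x ^ p ≤ K * θ ^ m * F) (n : ℕ) :
    ∑ x, (∑ m ∈ Finset.range n, b m x) ^ p ≤ K / (1 - θ ^ (1 / p)) ^ p * F := by
  have hp0 : 0 < p := by linarith
  have hS : 0 ≤ ∑ x, (∑ m ∈ Finset.range n, b m x) ^ p :=
    Finset.sum_nonneg fun _ _ => Real.rpow_nonneg (Finset.sum_nonneg fun _ _ => hb _ _) _
  have hq0 : 0 < θ ^ (1 / p) := by positivity
  have hq1 : θ ^ (1 / p) < 1 := Real.rpow_lt_one hθ.le hθ1 (by positivity)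
  have h1 : (∑ x, (∑ m ∈ Finset.range n, b m x) ^ p) ^ (1 / p) ≤ (K * F) ^ (1 / p) * (1 - θ ^ (1 / p))⁻¹ := by
    refine (lp_sum hp.le b hb n).trans ?_
    calc ∑ m ∈ Finset.range n, (∑ x, b m x ^ p) ^ (1 / p)
        ≤ ∑ m ∈ Finset.range n, (K * F) ^ (1 / p) * (θ ^ (1 / p)) ^ m := by
          refine Finset.sum_le_sum fun m _ => ?_
          refine (Real.rpow_le_rpow (Finset.sum_nonneg fun _ _ => Real.rpow_nonneg (hb _ _) _) (h m) (by positivity)).trans (le_of_eq ?_)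
          rw [show K * θ ^ m * F = (K * F) * θ ^ m by ring, Real.mul_rpow (by positivity) (by positivity)]
          congr 1
          rw [← Real.rpow_natCast, ← Real.rpow_natCast, ← Real.rpow_mul hθ.le, ← Real.rpow_mul hθ.le, mul_comm]
      _ ≤ _ := by
          rw [← Finset.mul_sum]
          gcongr
          rw [← tsum_geometric_of_lt_one hq0.le hq1]
          exact (summable_geometric_of_lt_one hq0.le hq1).sum_le_tsum _ (fun _ _ => by positivity)
  have h2 := Real.rpow_le_rpow (by positivity) h1 hp0.le
  rw [← Real.rpow_mul hS, one_div_mul_cancel hp0.ne', Real.rpow_one,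
    Real.mul_rpow (by positivity) (by rw [inv_nonneg]; linarith), ← Real.rpow_mul (by positivity),
    one_div_mul_cancel hp0.ne', Real.rpow_one, Real.inv_rpow (by linarith)] at h2
  refine h2.trans (le_of_eq ?_)
  ring

lemma add3_rpow {a b c p : ℝ} (ha : 0 ≤ a) (hb : 0 ≤ b) (hc : 0 ≤ c) (hp : 0 ≤ p) :
    (a + b + c) ^ p ≤ 3 ^ p * (a ^ p + b ^ p + c ^ p) := by
  have h : ∀ M, a ≤ M → b ≤ M → c ≤ M → 0 ≤ M → (a + b + c) ^ p ≤ 3 ^ p * M ^ p := by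
    intro M h1 h2 h3 h4
    rw [← Real.mul_rpow (by norm_num) h4]
    exact Real.rpow_le_rpow (by positivity) (by linarith) hp
  have pa := Real.rpow_nonneg ha p
  have pb := Real.rpow_nonneg hb p
  have pc := Real.rpow_nonneg hc p
  have h3 : (0:ℝ) ≤ 3 ^ p := by positivity
  rcases le_total a b with h1 | h1 <;> rcases le_total b c with h2 | h2 <;> rcases le_total a c with h4 | h4
  · refine (h c (by linarith) h2 le_rfl hc).trans ?_; gcongr; linarith
  · refine (h c (by linarith) h2 le_rfl hc).trans ?_; gcongr; linarith
  · refine (h b h1 le_rfl h2 hb).trans ?_; gcongr; linarith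
  · refine (h b h1 le_rfl h2 hb).trans ?_; gcongr; linarith
  · refine (h c h4 h2 le_rfl hc).trans ?_; gcongr; linarith
  · refine (h a le_rfl h1 h4 ha).trans ?_; gcongr; linarith
  · refine (h a le_rfl h1 (by linarith) ha).trans ?_; gcongr; linarith
  · refine (h a le_rfl h1 h4 ha).trans ?_; gcongr; linarith

variable (v : ℕ → V → G) (J : ℕ) (W : ℕ → Finset ι) (s : ι → G)

lemma Tav_zero (f : G → ℝ) (x : G) : Tav v J 0 f x = f x := by
  simp [Tav, itav, posn_zero]

lemma sum_Dop_from (f : G → ℝ) (x : G) (j : ℕ) (hj : j ≤ J) :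
    ∑ i ∈ Finset.Ico j (J + 1), Dop v J i f x = Tav v J j f x := by
  rw [Finset.sum_Ico_succ_top hj]
  have : ∑ i ∈ Finset.Ico j J, Dop v J i f x = ∑ i ∈ Finset.Ico j J, (Tav v J i f x - Tav v J (i+1) f x) :=
    Finset.sum_congr rfl fun i hi => by simp [Dop, (Finset.mem_Ico.1 hi).2]
  have h2 : ∑ i ∈ Finset.Ico j J, (Tav v J i f x - Tav v J (i+1) f x) = Tav v J j f x - Tav v J J f x := by
    have h3 := Finset.sum_Ico_sub (fun i => Tav v J i f x) hj
    rw [← neg_inj, ← Finset.sum_neg_distrib, neg_sub, ← h3]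
    exact Finset.sum_congr rfl fun i _ => by ring
  rw [this, h2]
  simp [Dop]

lemma av_sum {κ : Type*} (U : Finset ι) (S : Finset κ) (F : κ → G → ℝ) (x : G) :
    av U s (fun y => ∑ i ∈ S, F i y) x = ∑ i ∈ S, av U s (F i) x := by
  simp only [av]
  rw [Finset.sum_comm, Finset.mul_sum]

lemma decomp (f : G → ℝ) (x : G) (j : ℕ) (hj1 : 1 ≤ j) (hj : j ≤ J) :
    av (W j) s f x ≤ Tav v J j f x + ∑ m ∈ Finset.range (J + 1), Qh v J W s m f x +
      ∑ m ∈ Finset.range (J + 1), Ql v J W s m f x := by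
  have e0 : f = fun y => ∑ i ∈ Finset.Ico 0 (J + 1), Dop v J i f y := by
    ext y; rw [sum_Dop_from v J f y 0 (by omega), Tav_zero]
  have e1 : av (W j) s f x = ∑ i ∈ Finset.range j, av (W j) s (Dop v J i f) x +
      ∑ i ∈ Finset.Ico j (J + 1), (av (W j) s (Dop v J i f) x - Dop v J i f x) + Tav v J j f x := by
    conv_lhs => rw [e0]
    rw [av_sum, Finset.sum_sub_distrib, sum_Dop_from v J f x j hj,
      ← Finset.sum_Ico_consecutive _ (Nat.zero_le j) (show j ≤ J + 1 by omega), Finset.range_eq_Ico]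
    ring
  have hh : ∑ i ∈ Finset.range j, av (W j) s (Dop v J i f) x ≤ ∑ m ∈ Finset.range (J + 1), Qh v J W s m f x := by
    rw [← Finset.sum_range_reflect]
    refine le_trans ?_ (Finset.sum_le_sum_of_subset_of_nonneg (Finset.range_mono (show j ≤ J + 1 by omega))
      fun _ _ _ => Real.sqrt_nonneg _)
    refine Finset.sum_le_sum fun m hm => ?_
    have hm := Finset.mem_range.1 hm
    refine Real.le_sqrt_of_sq_le ?_
    have := Finset.single_le_sum (f := fun i => av (W (i + 1 + m)) s (Dop v J i f) x ^ 2)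
      (s := (Finset.range (J + 1)).filter (fun i => i + 1 + m ≤ J)) (fun _ _ => sq_nonneg _)
      (a := j - 1 - m) (by simp; omega)
    simp only [show j - 1 - m + 1 + m = j by omega] at this
    exact this
  have hl : ∑ i ∈ Finset.Ico j (J + 1), (av (W j) s (Dop v J i f) x - Dop v J i f x) ≤
      ∑ m ∈ Finset.range (J + 1), Ql v J W s m f x := by
    rw [Finset.sum_Ico_eq_sum_range]
    refine le_trans ?_ (Finset.sum_le_sum_of_subset_of_nonneg (Finset.range_mono (show J + 1 - j ≤ J + 1 by omega))
      fun _ _ _ => Real.sqrt_nonneg _)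
    refine Finset.sum_le_sum fun m hm => ?_
    have hm := Finset.mem_range.1 hm
    refine Real.le_sqrt_of_sq_le ?_
    exact Finset.single_le_sum (f := fun j => (av (W j) s (Dop v J (j + m) f) x - Dop v J (j + m) f x) ^ 2)
      (s := (Finset.Icc 1 J).filter (fun j => j + m ≤ J)) (fun _ _ => sq_nonneg _)
      (a := j) (by simp; omega)
  linarith

theorem assemble {p K θ : ℝ} (hp : 1 < p) (hK : 0 ≤ K) (hθ : 0 < θ) (hθ1 : θ < 1)
    (H : ∀ m (f : G → ℝ), ∑ x, Qh v J W s m f x ^ p ≤ K * θ ^ m * ∑ x, |f x| ^ p ∧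
      ∑ x, Ql v J W s m f x ^ p ≤ K * θ ^ m * ∑ x, |f x| ^ p) :
    MaxB J W s p (3 ^ p * ((p / (p - 1)) ^ p + K / (1 - θ ^ (1 / p)) ^ p + K / (1 - θ ^ (1 / p)) ^ p)) := by
  intro f hf k hk
  have hF : 0 ≤ ∑ x, |f x| ^ p := Finset.sum_nonneg fun _ _ => by positivity
  have hab : ∑ x, |f x| ^ p = ∑ x, f x ^ p := Finset.sum_congr rfl fun x _ => by rw [abs_of_nonneg (hf x)]
  have a1 := Tav_max v J hp hf k (fun x => (hk x).2)
  have a2 := lp_geom hp hK hF hθ hθ1 (fun m => Qh v J W s m f) (fun _ _ => Real.sqrt_nonneg _)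
    (fun m => (H m f).1) (J + 1)
  have a3 := lp_geom hp hK hF hθ hθ1 (fun m => Ql v J W s m f) (fun _ _ => Real.sqrt_nonneg _)
    (fun m => (H m f).2) (J + 1)
  rw [hab] at a2 a3
  calc ∑ x, av (W (k x)) s f x ^ p ≤ ∑ x, 3 ^ p * (Tav v J (k x) f x ^ p +
        (∑ m ∈ Finset.range (J + 1), Qh v J W s m f x) ^ p + (∑ m ∈ Finset.range (J + 1), Ql v J W s m f x) ^ p) := by
        refine Finset.sum_le_sum fun x _ => ?_
        refine (Real.rpow_le_rpow (av_nonneg _ _ hf x) (decomp v J W s f x (k x) (hk x).1 (hk x).2) (by linarith)).trans ?_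
        exact add3_rpow (Tav_nonneg v J _ hf x) (Finset.sum_nonneg fun _ _ => Real.sqrt_nonneg _)
          (Finset.sum_nonneg fun _ _ => Real.sqrt_nonneg _) (by linarith)
    _ = 3 ^ p * (∑ x, Tav v J (k x) f x ^ p + ∑ x, (∑ m ∈ Finset.range (J + 1), Qh v J W s m f x) ^ p
        + ∑ x, (∑ m ∈ Finset.range (J + 1), Ql v J W s m f x) ^ p) := by
        rw [← Finset.mul_sum, Finset.sum_add_distrib, Finset.sum_add_distrib]
    _ ≤ 3 ^ p * ((p / (p - 1)) ^ p * ∑ x, f x ^ p + K / (1 - θ ^ (1 / p)) ^ p * ∑ x, f x ^ p +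
        K / (1 - θ ^ (1 / p)) ^ p * ∑ x, f x ^ p) := by gcongr
    _ = _ := by ring

end assem

/-- dimension free maximal bound -/
def Bdd (p : ℝ) : Prop := ∃ B : ℝ, 0 ≤ B ∧ ∀ (G : Type) [AddCommGroup G] [Fintype G] (V : Type) [Fintype V]
  [Nonempty V] (ι : Type) (v : ℕ → V → G) (J : ℕ) (W : ℕ → Finset ι) (s : ι → G),
  (∀ j, (W j).Nonempty) → SymHyp v J W s → MaxB J W s p B

lemma geom_const {p K θ : ℝ} (hp : 1 < p) (hK : 0 ≤ K) (hθ : 0 < θ) (hθ1 : θ < 1) :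
    0 ≤ (3 ^ p * ((p / (p - 1)) ^ p + K / (1 - θ ^ (1 / p)) ^ p + K / (1 - θ ^ (1 / p)) ^ p)) := by
  have hq1 : θ ^ (1 / p) < 1 := Real.rpow_lt_one hθ.le hθ1 (by positivity)
  have : 0 < 1 - θ ^ (1 / p) := by linarith
  have : 0 < p - 1 := by linarith
  positivity

lemma bdd_two : Bdd 2 := by
  refine ⟨_, geom_const (p := 2) (K := 64) (θ := 4⁻¹) (by norm_num) (by norm_num) (by norm_num) (by norm_num), ?_⟩
  intro G _ _ V _ _ ι v J W s hW HS
  refine assemble v J W s (by norm_num) (by norm_num) (by norm_num) (by norm_num) fun m f => ?_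
  have h1 := Qh_two v J W s HS m f
  have h2 := Ql_two v J W s HS m f
  simp only [Real.rpow_two, sq_abs]
  exact ⟨h1, h2⟩

lemma bdd_step {p0 p : ℝ} (hp0 : 1 < p0) (h : Bdd p0) (hp : 2 * (p0 / (1 + p0)) < p) (hp2 : p < 2) : Bdd p := by
  obtain ⟨B, hB, H⟩ := h
  set p1 := 2 * (p0 / (1 + p0)) with hp1
  have h1 : 1 < p1 := by
    rw [hp1, ← mul_div_assoc, lt_div_iff₀ (by linarith)]; linarith
  have hK : 0 ≤ 2 ^ p * p * ((2 * (B + 2) * Dc p1) / (p - p1) + 64 / (2 - p)) := by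
    have := Dc_nonneg h1
    have : 0 < p - p1 := by linarith
    have : 0 < 2 - p := by linarith
    have : 0 < p := by linarith
    positivity
  have hθ1 : (2:ℝ) ^ (p1 - p) < 1 := Real.rpow_lt_one_of_one_lt_of_neg (by norm_num) (by linarith)
  refine ⟨_, geom_const (p := p) (θ := (2:ℝ) ^ (p1 - p)) (by linarith) hK (by positivity) hθ1, ?_⟩
  intro G _ _ V _ _ ι v J W s hW HS
  exact assemble v J W s (by linarith) hK (by positivity) hθ1 fun m f =>
    Q_p v J W s hW HS hp0 hB hp1 hp hp2 (H G V ι v J W s hW HS) m f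

lemma av_jensen {G ι : Type*} [AddCommGroup G] (W : Finset ι) (hW : W.Nonempty) (s : ι → G) {f : G → ℝ} (hf : ∀ x, 0 ≤ f x)
    {q : ℝ} (hq : 1 ≤ q) (x : G) : av W s f x ^ q ≤ av W s (fun y => f y ^ q) x := by
  have : (0:ℝ) < W.card := by exact_mod_cast hW.card_pos
  simp only [av]
  rw [Finset.mul_sum, Finset.mul_sum]
  exact Real.rpow_arith_mean_le_arith_mean_rpow W (fun _ => (W.card : ℝ)⁻¹) _
    (fun _ _ => by positivity) (by simp [this.ne']) (fun e _ => hf _) hq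

lemma bdd_up {p0 p : ℝ} (hp0 : 1 < p0) (h : Bdd p0) (hp : p0 ≤ p) : Bdd p := by
  obtain ⟨B, hB, H⟩ := h
  refine ⟨B, hB, ?_⟩
  intro G _ _ V _ _ ι v J W s hW HS f hf k hk
  have h1 : 1 ≤ p / p0 := by rw [le_div_iff₀ (by linarith)]; linarith
  have e : p = p / p0 * p0 := by field_simp
  have := H G V ι v J W s hW HS (fun y => f y ^ (p / p0)) (fun y => Real.rpow_nonneg (hf y) _) k hk
  calc ∑ x, av (W (k x)) s f x ^ p ≤ ∑ x, av (W (k x)) s (fun y => f y ^ (p / p0)) x ^ p0 := by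
        refine Finset.sum_le_sum fun x _ => ?_
        conv_lhs => rw [e]
        rw [Real.rpow_mul (av_nonneg _ _ hf x)]
        exact Real.rpow_le_rpow (Real.rpow_nonneg (av_nonneg _ _ hf x) _) (av_jensen _ (hW _) s hf h1 x) (by linarith)
    _ ≤ _ := this
    _ = _ := by
        congr 1
        refine Finset.sum_congr rfl fun x _ => ?_
        rw [← Real.rpow_mul (hf x), ← e]

lemma bdd_ind (n : ℕ) : ∀ p : ℝ, 1 < p → (1 / 2 : ℝ) ^ (n + 1) < 1 - 1 / p → Bdd p := by
  induction n with
  | zero =>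
    intro p hp h
    refine bdd_up (p0 := 2) (by norm_num) bdd_two ?_
    have h1 : 1 / p < 1 / 2 := by norm_num at h ⊢; linarith
    rw [div_lt_div_iff₀ (by linarith) (by norm_num)] at h1
    linarith
  | succ n ih =>
    intro p hp h
    rcases le_or_gt 2 p with h2 | h2
    · exact bdd_up (p0 := 2) (by norm_num) bdd_two h2
    have hh : (1 / 2 : ℝ) ^ (n + 1) < 2 * (1 - 1 / p) := by
      rw [pow_succ (1/2:ℝ) (n+1)] at h; linarith
    obtain ⟨y, hy1, hy2⟩ := exists_between hh
    have hy0 : 0 < y := lt_trans (by positivity) hy1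
    have hp2 : 1 / 2 < 1 / p := one_div_lt_one_div_of_lt (by linarith) h2
    have hy3 : y < 1 := by linarith
    have h1y : 0 < 1 - y := by linarith
    have hp0 : 1 < 1 / (1 - y) := by rw [lt_div_iff₀ h1y]; linarith
    refine bdd_step hp0 (ih (1 / (1 - y)) hp0 ?_) ?_ h2
    · rw [one_div_one_div]; linarith
    · have e : 2 * (1 / (1 - y) / (1 + 1 / (1 - y))) = 2 / (2 - y) := by
        have : 2 - y ≠ 0 := by linarith
        have h4 : 1 + 1 / (1 - y) = (2 - y) / (1 - y) := by field_simp; ring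
        rw [h4]; field_simp
      rw [e, div_lt_iff₀ (by linarith)]
      have : p * (1 / p) = 1 := by field_simp
      nlinarith

theorem bdd_all {p : ℝ} (hp : 1 < p) : Bdd p := by
  have : 0 < 1 - 1 / p := by
    rw [sub_pos, div_lt_one (by linarith)]; exact hp
  obtain ⟨n, hn⟩ := exists_pow_lt_of_lt_one this (show (1/2:ℝ) < 1 by norm_num)
  refine bdd_ind n p hp (lt_of_le_of_lt ?_ hn)
  rw [pow_succ]
  have : (0:ℝ) ≤ (1/2)^n := by positivity
  linarith


section oned

open scoped ComplexConjugate

noncomputable def mL (L : ℕ) (z : ℂ) : ℂ := (L : ℂ)⁻¹ * ∑ k ∈ Finset.range L, z ^ k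

lemma one_sub_pow_le {z : ℂ} (hz : ‖z‖ = 1) (k : ℕ) : ‖1 - z ^ k‖ ≤ k * ‖1 - z‖ := by
  induction k with
  | zero => simp
  | succ k ih =>
    have : 1 - z ^ (k + 1) = (1 - z ^ k) + z ^ k * (1 - z) := by ring
    rw [this]
    refine (norm_add_le _ _).trans ?_
    rw [norm_mul, norm_pow, hz, one_pow]; push_cast; linarith

lemma norm_sub_sq_c (a b : ℂ) : ‖a - b‖ ^ 2 = ‖a‖ ^ 2 - 2 * (a * conj b).re + ‖b‖ ^ 2 := by
  rw [← Complex.normSq_eq_norm_sq, ← Complex.normSq_eq_norm_sq, ← Complex.normSq_eq_norm_sq, Complex.normSq_sub]; ring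

lemma mL_var {z : ℂ} (hz : ‖z‖ = 1) {L : ℕ} (hL : 0 < L) :
    ∑ y ∈ Finset.range L, ‖z ^ y - mL L z‖ ^ 2 = L * (1 - ‖mL L z‖ ^ 2) := by
  have hL' : (L : ℂ) ≠ 0 := by exact_mod_cast hL.ne'
  simp only [norm_sub_sq_c, norm_pow, hz, one_pow]
  rw [Finset.sum_add_distrib, Finset.sum_sub_distrib, ← Finset.mul_sum, ← Complex.re_sum, ← Finset.sum_mul]
  have : ∑ k ∈ Finset.range L, z ^ k = L * mL L z := by rw [mL]; field_simp
  rw [this, mul_assoc, Complex.mul_conj']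
  have h2 : ((L : ℂ) * (‖mL L z‖ : ℂ) ^ 2).re = L * ‖mL L z‖ ^ 2 := by
    rw [show ((L : ℂ) * (‖mL L z‖ : ℂ) ^ 2) = ((L * ‖mL L z‖ ^ 2 : ℝ) : ℂ) by push_cast; ring, Complex.ofReal_re]
  rw [h2]; simp; ring

lemma half_sq (a b c : ℂ) : ‖a - b‖ ^ 2 ≤ 2 * (‖a - c‖ ^ 2 + ‖b - c‖ ^ 2) := by
  have h : ‖a - b‖ ≤ ‖a - c‖ + ‖b - c‖ := by
    rw [show a - b = (a - c) - (b - c) by ring]; exact norm_sub_le _ _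
  nlinarith [norm_nonneg (a - b), sq_nonneg (‖a - c‖ - ‖b - c‖), norm_nonneg (a - c), norm_nonneg (b - c)]

lemma mL_pair {z : ℂ} (hz : ‖z‖ = 1) {L a h : ℕ} (hL : 0 < L) (h1 : a ≤ h) (h2 : h + a ≤ L) :
    a * ‖1 - z ^ h‖ ^ 2 ≤ 2 * (L * (1 - ‖mL L z‖ ^ 2)) := by
  rw [← mL_var hz hL]
  set F : ℕ → ℝ := fun y => ‖z ^ y - mL L z‖ ^ 2 with hF
  have e1 : ∑ y ∈ Finset.range a, F y + ∑ y ∈ Finset.range a, F (h + y) ≤ ∑ y ∈ Finset.range L, F y := by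
    calc _ ≤ ∑ y ∈ Finset.range h, F y + ∑ y ∈ Finset.range a, F (h + y) := by
          gcongr
      _ = ∑ y ∈ Finset.range (h + a), F y := (Finset.sum_range_add _ _ _).symm
      _ ≤ _ := by gcongr
  calc (a:ℝ) * ‖1 - z ^ h‖ ^ 2 = ∑ y ∈ Finset.range a, ‖1 - z ^ h‖ ^ 2 := by simp
    _ ≤ ∑ y ∈ Finset.range a, 2 * (F y + F (h + y)) := by
        refine Finset.sum_le_sum fun y _ => ?_
        have : ‖1 - z ^ h‖ = ‖z ^ y - z ^ (h + y)‖ := by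
          rw [show z ^ y - z ^ (h + y) = z ^ y * (1 - z ^ h) by ring, norm_mul, norm_pow, hz]; simp
        rw [this]
        exact half_sq _ _ _
    _ = 2 * (∑ y ∈ Finset.range a, F y + ∑ y ∈ Finset.range a, F (h + y)) := by
        rw [← Finset.mul_sum, Finset.sum_add_distrib]
    _ ≤ _ := by gcongr

lemma mL_up {z : ℂ} (hz : ‖z‖ = 1) {L : ℕ} (hL : 2 ≤ L) :
    ‖mL L z‖ ^ 2 * (1 + L ^ 2 * ‖1 - z‖ ^ 2 / 32) ≤ 1 := by
  have hL0 : 0 < L := by omega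
  have hLr : (0:ℝ) < L := by exact_mod_cast hL0
  have e : (L * mL L z) * (1 - z) = 1 - z ^ L := by
    have hL' : (L : ℂ) ≠ 0 := by exact_mod_cast hL0.ne'
    have : ∑ k ∈ Finset.range L, z ^ k = L * mL L z := by rw [mL]; field_simp
    rw [← this]
    have := geom_sum_mul z L
    linear_combination -this
  have e2 : L ^ 2 * ‖mL L z‖ ^ 2 * ‖1 - z‖ ^ 2 = ‖1 - z ^ L‖ ^ 2 := by
    rw [← e, norm_mul, norm_mul]; simp; ring
  obtain ⟨a, ha⟩ : ∃ a, a = L / 2 := ⟨_, rfl⟩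
  have p1 := mL_pair hz hL0 (a := a) (h := a) le_rfl (by omega)
  have p2 := mL_pair hz hL0 (a := a) (h := L - a) (by omega) (by omega)
  have p3 : ‖1 - z ^ L‖ ^ 2 ≤ 2 * (‖1 - z ^ a‖ ^ 2 + ‖1 - z ^ (L - a)‖ ^ 2) := by
    have h : ‖1 - z ^ L‖ ≤ ‖1 - z ^ a‖ + ‖1 - z ^ (L - a)‖ := by
      have : 1 - z ^ L = (1 - z ^ a) + z ^ a * (1 - z ^ (L - a)) := by
        conv_lhs => rw [show L = a + (L - a) by omega]
        ring
      rw [this]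
      refine (norm_add_le _ _).trans ?_
      rw [norm_mul, norm_pow, hz]; simp
    nlinarith [norm_nonneg (1 - z ^ L), sq_nonneg (‖1 - z ^ a‖ - ‖1 - z ^ (L - a)‖), norm_nonneg (1 - z ^ a), norm_nonneg (1 - z ^ (L - a))]
  have ha3 : (L : ℝ) ≤ 3 * a := by
    have : L ≤ 3 * a := by omega
    exact_mod_cast this
  have p4 : (L:ℝ) * ‖1 - z ^ L‖ ^ 2 ≤ L * (24 * (1 - ‖mL L z‖ ^ 2)) := by
    calc (L:ℝ) * ‖1 - z ^ L‖ ^ 2 ≤ (3 * a) * (2 * (‖1 - z ^ a‖ ^ 2 + ‖1 - z ^ (L - a)‖ ^ 2)) := by gcongr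
      _ ≤ _ := by nlinarith
  have p5 := le_of_mul_le_mul_left p4 hLr
  nlinarith [sq_nonneg ‖1 - z ^ L‖]

lemma norm_mL_le {z : ℂ} (hz : ‖z‖ = 1) {L : ℕ} (hL : 0 < L) : ‖mL L z‖ ≤ 1 := by
  have hLr : (0:ℝ) < L := by exact_mod_cast hL
  rw [mL, norm_mul, norm_inv, Complex.norm_natCast, inv_mul_le_one₀ hLr]
  refine (norm_sum_le _ _).trans ?_
  simp [hz]

lemma mL_low {z : ℂ} (hz : ‖z‖ = 1) {L : ℕ} (hL : 0 < L) :
    1 - ‖mL L z‖ ^ 2 ≤ L ^ 2 * ‖1 - z‖ ^ 2 := by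
  have hLr : (0:ℝ) < L := by exact_mod_cast hL
  have hL' : (L : ℂ) ≠ 0 := by exact_mod_cast hL.ne'
  have h1 : ∑ y ∈ Finset.range L, ‖1 - z ^ y‖ ^ 2 = L * (2 - 2 * (mL L z).re) := by
    have : ∀ y, ‖1 - z ^ y‖ ^ 2 = 2 - 2 * (z ^ y).re := by
      intro y
      rw [norm_sub_rev, norm_sub_sq_c, norm_pow, hz]; simp; ring
    simp only [this]
    rw [Finset.sum_sub_distrib, ← Finset.mul_sum, ← Complex.re_sum]
    have : ∑ k ∈ Finset.range L, z ^ k = L * mL L z := by rw [mL]; field_simp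
    rw [this]; simp; ring
  have h2 : ∑ y ∈ Finset.range L, ‖1 - z ^ y‖ ^ 2 ≤ L * (L ^ 2 * ‖1 - z‖ ^ 2) := by
    calc _ ≤ ∑ y ∈ Finset.range L, (L ^ 2 * ‖1 - z‖ ^ 2) := by
          refine Finset.sum_le_sum fun y hy => ?_
          rw [← mul_pow]
          have hy : (y:ℝ) ≤ L := by exact_mod_cast (Finset.mem_range.1 hy).le
          gcongr
          exact (one_sub_pow_le hz y).trans (by gcongr)
      _ = _ := by simp
  rw [h1] at h2
  have h3 := le_of_mul_le_mul_left h2 hLr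
  have h4 := norm_sub_sq_c 1 (mL L z)
  simp at h4
  nlinarith [sq_nonneg ‖1 - mL L z‖]

noncomputable def Dn (n : ℕ) (z : ℂ) : ℂ := ((2 * n + 1 : ℕ) : ℂ)⁻¹ * ∑ k ∈ Finset.Icc (-n : ℤ) n, z ^ k

lemma icc_sum {M : Type*} [AddCommMonoid M] (n : ℕ) (F : ℤ → M) :
    ∑ k ∈ Finset.Icc (-n : ℤ) n, F k = ∑ i ∈ Finset.range (2 * n + 1), F ((i : ℤ) - n) := by
  symm
  refine Finset.sum_bij (fun i _ => (i : ℤ) - n) ?_ ?_ ?_ ?_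
  · intro i hi; simp at hi ⊢; omega
  · intro i _ j _ h; omega
  · intro k hk
    simp at hk
    exact ⟨(k + n).toNat, by simp; omega, by omega⟩
  · intros; rfl

lemma norm_Dn {z : ℂ} (hz : ‖z‖ = 1) (n : ℕ) : ‖Dn n z‖ = ‖mL (2 * n + 1) z‖ := by
  have h0 : z ≠ 0 := by intro h; simp [h] at hz
  have : Dn n z = z ^ (-n : ℤ) * mL (2 * n + 1) z := by
    rw [Dn, mL, icc_sum]
    rw [mul_left_comm, Finset.mul_sum (s := Finset.range _) (a := z ^ (-n : ℤ))]
    congr 1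
    refine Finset.sum_congr rfl fun i _ => ?_
    rw [sub_eq_neg_add, zpow_add₀ h0, zpow_natCast]
  rw [this, norm_mul, norm_zpow, hz]; simp

lemma one_sub_zpow_le {z : ℂ} (hz : ‖z‖ = 1) (k : ℤ) : ‖1 - z ^ k‖ ≤ |(k : ℝ)| * ‖1 - z‖ := by
  have h0 : z ≠ 0 := by intro h; simp [h] at hz
  obtain ⟨n, rfl | rfl⟩ := k.eq_nat_or_neg
  · simpa using one_sub_pow_le hz n
  · have : 1 - z ^ (-n : ℤ) = - (z ^ (-n : ℤ) * (1 - z ^ n)) := by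
      rw [mul_sub, ← zpow_natCast, ← zpow_add₀ h0]; simp
    rw [this, norm_neg, norm_mul, norm_zpow, hz]
    simpa using one_sub_pow_le hz n

lemma Dn_low {z : ℂ} (hz : ‖z‖ = 1) (n : ℕ) : ‖1 - Dn n z‖ ≤ n ^ 2 * ‖1 - z‖ ^ 2 := by
  have h0 : z ≠ 0 := by intro h; simp [h] at hz
  have hL' : ((2 * n + 1 : ℕ) : ℂ) ≠ 0 := by exact_mod_cast (Nat.succ_ne_zero (2 * n))
  have hsym : ∑ k ∈ Finset.Icc (-n : ℤ) n, z ^ k = ∑ k ∈ Finset.Icc (-n : ℤ) n, z ^ (-k) := by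
    refine Finset.sum_bij (fun k _ => -k) ?_ ?_ ?_ ?_
    · intro k hk; simp at hk ⊢; omega
    · intro a _ b _ h; simpa using h
    · intro b hb; exact ⟨-b, by simp at hb ⊢; omega, by simp⟩
    · intros; simp
  have hcard : ∑ k ∈ Finset.Icc (-n : ℤ) n, (1 : ℂ) = ((2 * n + 1 : ℕ) : ℂ) := by
    rw [icc_sum]; simp
  have key : ((2 * n + 1 : ℕ) : ℂ) * (2 * (1 - Dn n z)) = ∑ k ∈ Finset.Icc (-n : ℤ) n, (2 - z ^ k - z ^ (-k)) := by
    rw [Finset.sum_sub_distrib, Finset.sum_sub_distrib, ← hsym]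
    have h2 : ∑ k ∈ Finset.Icc (-n : ℤ) n, (2 : ℂ) = 2 * ((2 * n + 1 : ℕ) : ℂ) := by
      rw [← hcard, Finset.mul_sum]; simp
    have h3 : ∑ k ∈ Finset.Icc (-n : ℤ) n, z ^ k = ((2 * n + 1 : ℕ) : ℂ) * Dn n z := by
      rw [Dn]; field_simp
    rw [h2, h3]; ring
  have hb : ‖∑ k ∈ Finset.Icc (-n : ℤ) n, (2 - z ^ k - z ^ (-k))‖ ≤ ((2 * n + 1 : ℕ) : ℝ) * (n ^ 2 * ‖1 - z‖ ^ 2) := by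
    refine (norm_sum_le _ _).trans ?_
    calc _ ≤ ∑ k ∈ Finset.Icc (-n : ℤ) n, ((n:ℝ) ^ 2 * ‖1 - z‖ ^ 2) := by
          refine Finset.sum_le_sum fun k hk => ?_
          have e : 2 - z ^ k - z ^ (-k) = (1 - z ^ k) * (1 - z ^ (-k)) := by
            have : z ^ k * z ^ (-k) = 1 := by rw [← zpow_add₀ h0]; simp
            linear_combination -this
          rw [e, norm_mul]
          have a1 := one_sub_zpow_le hz k
          have a2 := one_sub_zpow_le hz (-k)
          simp only [Finset.mem_Icc] at hk
          have a3 : |(k : ℝ)| ≤ n := by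
            rw [abs_le]
            exact ⟨by exact_mod_cast hk.1, by exact_mod_cast hk.2⟩
          rw [Int.cast_neg, abs_neg] at a2
          calc _ ≤ (|(k : ℝ)| * ‖1 - z‖) * (|(k : ℝ)| * ‖1 - z‖) := by gcongr
            _ ≤ ((n:ℝ) * ‖1 - z‖) * (n * ‖1 - z‖) := by gcongr
            _ = _ := by ring
      _ = _ := by rw [icc_sum]; simp
  rw [← key, norm_mul, Complex.norm_natCast, norm_mul] at hb
  have hpos : (0:ℝ) < ((2 * n + 1 : ℕ) : ℝ) := by positivity
  have := le_of_mul_le_mul_left hb hpos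
  simp at this
  nlinarith [norm_nonneg (1 - Dn n z)]

lemma prod_up {κ : Type*} (S : Finset κ) (a x : κ → ℝ) (c : ℝ) (hc : 0 ≤ c) (ha : ∀ i, 0 ≤ a i) (hx : ∀ i, 0 ≤ x i)
    (h : ∀ i, a i * (1 + c * x i / 32) ≤ 1) : (∏ i ∈ S, a i) * (1 + c * (∑ i ∈ S, x i) / 32) ≤ 1 := by
  have h1 : 1 + ∑ i ∈ S, (c * x i / 32) ≤ ∏ i ∈ S, (1 + c * x i / 32) := by
    classical
    induction S using Finset.induction_on with
    | empty => simp
    | insert b S hb ih =>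
      rw [Finset.sum_insert hb, Finset.prod_insert hb]
      have : 0 ≤ c * x b / 32 := by have := hx b; positivity
      have : 0 ≤ ∑ i ∈ S, (c * x i / 32) := Finset.sum_nonneg fun i _ => by have := hx i; positivity
      nlinarith
  have e : c * (∑ i ∈ S, x i) / 32 = ∑ i ∈ S, (c * x i / 32) := by
    rw [Finset.mul_sum, Finset.sum_div]
  rw [e]
  calc _ ≤ (∏ i ∈ S, a i) * ∏ i ∈ S, (1 + c * x i / 32) :=
        mul_le_mul_of_nonneg_left h1 (Finset.prod_nonneg fun i _ => ha i)
    _ = ∏ i ∈ S, (a i * (1 + c * x i / 32)) := Finset.prod_mul_distrib.symm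
    _ ≤ 1 := Finset.prod_le_one (fun i _ => by have := ha i; have := hx i; positivity) fun i _ => h i

lemma prod_low {κ : Type*} (S : Finset κ) (D : κ → ℂ) (hD : ∀ i, ‖D i‖ ≤ 1) :
    ‖1 - ∏ i ∈ S, D i‖ ≤ ∑ i ∈ S, ‖1 - D i‖ := by
  classical
  induction S using Finset.induction_on with
  | empty => simp
  | insert b S hb ih =>
    rw [Finset.sum_insert hb, Finset.prod_insert hb]
    have : 1 - D b * ∏ i ∈ S, D i = (1 - D b) + D b * (1 - ∏ i ∈ S, D i) := by ring
    rw [this]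
    refine (norm_add_le _ _).trans ?_
    rw [norm_mul]
    have := mul_le_of_le_one_left (norm_nonneg (1 - ∏ i ∈ S, D i)) (hD b)
    linarith

lemma dyad (u : ℂ) (j : ℕ) : ∏ i ∈ Finset.range j, ((1 + u ^ (2 ^ i)) / 2) = mL (2 ^ j) u := by
  induction j with
  | zero => simp [mL]
  | succ j ih =>
    rw [Finset.prod_range_succ, ih, mL, mL, pow_succ 2 j, mul_two, Finset.sum_range_add]
    simp only [pow_add, ← Finset.mul_sum]
    push_cast
    have : (2:ℂ) ^ j ≠ 0 := pow_ne_zero _ (by norm_num)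
    field_simp
    ring

end oned


section conc
variable {d N : ℕ} [NeZero N]

open scoped ComplexConjugate

def vv (d N : ℕ) (i : ℕ) (ε : Fin d → Fin 2) : Fin d → ZMod N := fun l => ((2 ^ i * (ε l).val : ℕ) : ZMod N)

def sN (d N : ℕ) (w : Fin d → ℤ) : Fin d → ZMod N := fun l => -((w l : ℤ) : ZMod N)

noncomputable def WW (d : ℕ) (n : ℕ) : Finset (Fin d → ℤ) := Finset.Icc (fun _ => -(n : ℤ)) (fun _ => (n : ℤ))

lemma WW_nonempty (d n : ℕ) : (WW d n).Nonempty := ⟨0, by simp [WW, Pi.le_def]⟩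

lemma WW_card (d n : ℕ) : (WW d n).card = (2 * n + 1) ^ d := by
  rw [WW, Pi.card_Icc]
  simp
  congr 1
  omega

lemma char_int (ψ : AddChar (Fin d → ZMod N) ℂ) (k : Fin d → ℤ) :
    ψ (fun l => ((k l : ℤ) : ZMod N)) = ∏ l, ψ (Pi.single l 1) ^ (k l) := by
  have : (fun l => ((k l : ℤ) : ZMod N)) = ∑ l, k l • (Pi.single l 1 : Fin d → ZMod N) := by
    ext l
    rw [Finset.sum_apply]
    simp [Pi.single_apply]
  rw [this, char_sum]
  refine Finset.prod_congr rfl fun l _ => ?_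
  rw [AddChar.map_zsmul_eq_zpow]

lemma sym_conc (ψ : AddChar (Fin d → ZMod N) ℂ) (n : ℕ) :
    sym (WW d n) (sN d N) ψ = ∏ l, Dn n (ψ (Pi.single l 1)) := by
  have e : ∀ w, -(sN d N w) = fun l => ((w l : ℤ) : ZMod N) := by
    intro w; ext l; simp [sN]
  simp only [sym, e, char_int, WW_card, Dn]
  rw [Finset.prod_mul_distrib, Finset.prod_univ_sum]
  simp [WW, Pi.Icc_eq]

lemma bet_conc (ψ : AddChar (Fin d → ZMod N) ℂ) (i : ℕ) :
    bet (vv d N) i ψ = ∏ l, ((1 + (ψ (Pi.single l 1))⁻¹ ^ (2 ^ i)) / 2) := by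
  have e : ∀ w, -(vv d N i w) = fun l => (((-(2 ^ i * (w l).val : ℕ) : ℤ)) : ZMod N) := by
    intro w; ext l; simp [vv]
  simp only [bet, sym, e, char_int]
  have h : ∀ l, (1 + (ψ (Pi.single l 1))⁻¹ ^ (2 ^ i)) / 2 =
      (2:ℂ)⁻¹ * ∑ a : Fin 2, ψ (Pi.single l 1) ^ (-(2 ^ i * a.val : ℕ) : ℤ) := by
    intro l
    rw [Fin.sum_univ_two, zpow_neg, zpow_neg, zpow_natCast, zpow_natCast]
    simp; ring
  simp only [h]
  rw [Finset.prod_mul_distrib, Finset.prod_univ_sum]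
  simp

theorem symhyp (n : ℕ → ℕ) (hn : ∀ j, 1 ≤ j → 2 ^ j ≤ 2 * n j + 1 ∧ 2 * n j + 1 < 2 ^ (j + 1)) (J : ℕ) :
    SymHyp (vv d N) J (fun j => WW d (n j)) (sN d N) := by
  intro ψ
  set z : Fin d → ℂ := fun l => ψ (Pi.single l 1) with hzdef
  have hz : ∀ l, ‖z l‖ = 1 := fun l => AddChar.norm_apply _ _
  have hz' : ∀ l, ‖(z l)⁻¹‖ = 1 := fun l => by rw [norm_inv, hz, inv_one]
  have hzz : ∀ l, ‖1 - (z l)⁻¹‖ = ‖1 - z l‖ := by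
    intro l
    have h0 : z l ≠ 0 := by intro h; have := hz l; simp [h] at this
    have : 1 - (z l)⁻¹ = -((z l)⁻¹ * (1 - z l)) := by field_simp; ring
    rw [this, norm_neg, norm_mul, hz', one_mul]
  refine ⟨∑ l, ‖1 - z l‖ ^ 2, by positivity, fun j hj1 _ => ?_⟩
  obtain ⟨h1, h2⟩ := hn j hj1
  have htt : tt (vv d N) j ψ = ∏ l, ‖mL (2 ^ j) (z l)⁻¹‖ ^ 2 := by
    rw [tt, Finset.prod_pow, Finset.prod_pow, ← norm_prod, ← norm_prod]
    congr 2
    simp only [bet_conc]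
    rw [Finset.prod_comm]
    exact Finset.prod_congr rfl fun l _ => dyad _ _
  have hLj : 2 ≤ 2 ^ j := by
    calc 2 = 2 ^ 1 := by norm_num
      _ ≤ 2 ^ j := Nat.pow_le_pow_right (by norm_num) hj1
  have h4 : (4:ℝ) ^ j = ((2 ^ j : ℕ) : ℝ) ^ 2 := by
    push_cast; rw [← pow_mul, mul_comm, pow_mul]; norm_num
  have hsy : sym (WW d (n j)) (sN d N) ψ = ∏ l, Dn (n j) (z l) := sym_conc ψ (n j)
  refine ⟨?_, ?_, ?_, ?_⟩
  · simp only [hsy]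
    rw [norm_prod, ← Finset.prod_pow]
    refine prod_up _ _ _ _ (by positivity) (fun _ => by positivity) (fun _ => by positivity) fun l => ?_
    rw [norm_Dn (hz l)]
    refine le_trans ?_ (mL_up (hz l) (L := 2 * n j + 1) (by omega))
    have : (4:ℝ) ^ j ≤ ((2 * n j + 1 : ℕ) : ℝ) ^ 2 := by
      rw [h4]; gcongr
    gcongr
  · simp only [hsy]
    refine (prod_low _ _ fun l => ?_).trans ?_
    · rw [norm_Dn (hz l)]; exact norm_mL_le (hz l) (by omega)
    · rw [Finset.mul_sum]
      refine Finset.sum_le_sum fun l _ => (Dn_low (hz l) (n j)).trans ?_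
      rw [h4]
      have : n j ≤ 2 ^ j := by rw [pow_succ] at h2; omega
      gcongr
  · rw [htt]
    refine prod_up _ _ _ _ (by positivity) (fun _ => by positivity) (fun _ => by positivity) fun l => ?_
    have := mL_up (hz' l) (L := 2 ^ j) hLj
    rw [hzz, ← h4] at this
    exact this
  · rw [htt]
    have e : 1 - ∏ l, ‖mL (2 ^ j) (z l)⁻¹‖ ^ 2 ≤
        ‖1 - ∏ l, ((‖mL (2 ^ j) (z l)⁻¹‖ ^ 2 : ℝ) : ℂ)‖ := by
      rw [← Complex.ofReal_prod, ← Complex.ofReal_one, ← Complex.ofReal_sub, Complex.norm_real]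
      exact le_abs_self _
    have a0 : ∀ l, ‖mL (2 ^ j) (z l)⁻¹‖ ^ 2 ≤ 1 := fun l => pow_le_one₀ (norm_nonneg _) (norm_mL_le (hz' l) (by omega))
    refine (e.trans (prod_low _ _ fun l => ?_)).trans ?_
    · rw [Complex.norm_real, Real.norm_of_nonneg (by positivity)]
      exact a0 l
    · rw [Finset.mul_sum]
      refine Finset.sum_le_sum fun l _ => ?_
      rw [← Complex.ofReal_one, ← Complex.ofReal_sub, Complex.norm_real, Real.norm_of_nonneg (by linarith [a0 l]), h4, Complex.ofReal_one, ← hzz]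
      exact mL_low (hz' l) (by omega)

end conc


noncomputable def avZ (d n : ℕ) (f : (Fin d → ℤ) → ℝ) (x : Fin d → ℤ) : ℝ :=
  av (WW d n) (fun w => -w) f x

lemma avZ_nonneg {d n : ℕ} {f : (Fin d → ℤ) → ℝ} (hf : ∀ x, 0 ≤ f x) (x : Fin d → ℤ) :
    0 ≤ avZ d n f x := by
  unfold avZ av
  exact mul_nonneg (by positivity) (Finset.sum_nonneg fun w _ => hf _)

lemma mem_WW {d n : ℕ} {x : Fin d → ℤ} : x ∈ WW d n ↔ ∀ l, -(n:ℤ) ≤ x l ∧ x l ≤ n := by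
  simp [WW, Finset.mem_Icc, Pi.le_def, forall_and]

def liftZ (d N : ℕ) (g : Fin d → ZMod N) : Fin d → ℤ := fun l => (g l).valMinAbs

def castZ (d N : ℕ) (x : Fin d → ℤ) : Fin d → ZMod N := fun l => ((x l : ℤ) : ZMod N)

lemma liftZ_inj (d N : ℕ) : Function.Injective (liftZ d N) := by
  intro g h e
  ext l
  have := congrFun e l
  simp only [liftZ] at this
  rw [← ZMod.coe_valMinAbs (g l), this, ZMod.coe_valMinAbs]

lemma liftZ_castZ {d R : ℕ} {x : Fin d → ℤ} (hx : x ∈ WW d R) :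
    liftZ d (2 * R + 1) (castZ d (2 * R + 1) x) = x := by
  ext l
  have := mem_WW.1 hx l
  simp only [liftZ, castZ]
  rw [ZMod.valMinAbs_spec]
  refine ⟨rfl, ?_⟩
  simp only [Set.mem_Ioc]
  push_cast
  constructor <;> omega

lemma exists_box {d : ℕ} (S : Finset (Fin d → ℤ)) : ∃ R, S ⊆ WW d R := by
  refine ⟨∑ x ∈ S, ∑ l, (x l).natAbs, fun x hx => mem_WW.2 fun l => ?_⟩
  have h1 : (x l).natAbs ≤ ∑ l, (x l).natAbs :=
    Finset.single_le_sum (f := fun l => (x l).natAbs) (fun _ _ => Nat.zero_le _) (Finset.mem_univ l)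
  have h2 : ∑ l, (x l).natAbs ≤ ∑ x ∈ S, ∑ l, (x l).natAbs :=
    Finset.single_le_sum (f := fun x : Fin d → ℤ => ∑ l, (x l).natAbs) (fun _ _ => Nat.zero_le _) hx
  have := h1.trans h2
  generalize (∑ x ∈ S, ∑ l, (x l).natAbs) = Q at *
  omega

def ScaleC (n : ℕ → ℕ) : Prop := ∀ j, 1 ≤ j → 2 ^ j ≤ 2 * n j + 1 ∧ 2 * n j + 1 < 2 ^ (j + 1)

lemma transfer_fin {p B : ℝ} (hp : 1 < p) (hB0 : 0 ≤ B)
    (hB : ∀ (G : Type) [AddCommGroup G] [Fintype G] (V : Type) [Fintype V]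
      [Nonempty V] (ι : Type) (v : ℕ → V → G) (J : ℕ) (W : ℕ → Finset ι) (s : ι → G),
      (∀ j, (W j).Nonempty) → SymHyp v J W s → MaxB J W s p B)
    (d : ℕ) (n : ℕ → ℕ) (hn : ScaleC n) (f : (Fin d → ℤ) → ℝ) (hf : ∀ x, 0 ≤ f x) (J : ℕ)
    (S : Finset (Fin d → ℤ)) (k : (Fin d → ℤ) → ℕ) (hk : ∀ x, 1 ≤ k x ∧ k x ≤ J) :
    ∑ x ∈ S, ENNReal.ofReal (avZ d (n (k x)) f x) ^ p
      ≤ ENNReal.ofReal B * ∑' x, ENNReal.ofReal (f x) ^ p := by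
  obtain ⟨R1, hR1⟩ := exists_box S
  set R := R1 + ∑ j ∈ Finset.range (J + 1), n j with hR
  have hSR : ∀ x ∈ S, x ∈ WW d R := by
    intro x hx
    refine mem_WW.2 fun l => ?_
    have := mem_WW.1 (hR1 hx) l
    omega
  have hbox : ∀ x ∈ S, ∀ w ∈ WW d (n (k x)), x + -w ∈ WW d R := by
    intro x hx w hw
    refine mem_WW.2 fun l => ?_
    have h1 := mem_WW.1 (hR1 hx) l
    have h2 := mem_WW.1 hw l
    have h3 : n (k x) ≤ ∑ j ∈ Finset.range (J + 1), n j :=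
      Finset.single_le_sum (f := n) (fun _ _ => Nat.zero_le _)
        (Finset.mem_range.2 (by have := hk x; omega))
    simp only [Pi.add_apply, Pi.neg_apply]
    omega
  have key := hB (Fin d → ZMod (2 * R + 1)) (Fin d → Fin 2) (Fin d → ℤ) (vv d (2 * R + 1)) J
    (fun j => WW d (n j)) (sN d (2 * R + 1)) (fun j => WW_nonempty d _) (symhyp n hn J)
    (fun g => f (liftZ d _ g)) (fun g => hf _) (fun g => k (liftZ d _ g)) (fun g => hk _)
  have hav : ∀ x ∈ S, av (WW d (n (k (liftZ d (2*R+1) (castZ d _ x))))) (sN d (2 * R + 1))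
      (fun g => f (liftZ d _ g)) (castZ d _ x) = avZ d (n (k x)) f x := by
    intro x hx
    rw [liftZ_castZ (hSR x hx)]
    unfold avZ av
    congr 1
    refine Finset.sum_congr rfl fun w hw => ?_
    have e : castZ d (2 * R + 1) x + sN d (2 * R + 1) w = castZ d (2 * R + 1) (x + -w) := by
      ext l; simp [castZ, sN]
    simp only [e, liftZ_castZ (hbox x hx w hw)]
  have hinj : Set.InjOn (castZ d (2 * R + 1)) S := by
    intro x hx y hy e
    rw [← liftZ_castZ (hSR x hx), e, liftZ_castZ (hSR y hy)]
  have p0 : 0 ≤ p := by linarith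
  have step1 : ∑ x ∈ S, avZ d (n (k x)) f x ^ p ≤ B * ∑ g, f (liftZ d (2 * R + 1) g) ^ p := by
    refine le_trans ?_ key
    have e1 : ∑ x ∈ S, avZ d (n (k x)) f x ^ p
        = ∑ x ∈ S, av (WW d (n (k (liftZ d (2*R+1) (castZ d _ x))))) (sN d (2 * R + 1))
          (fun g => f (liftZ d _ g)) (castZ d _ x) ^ p :=
      Finset.sum_congr rfl (fun x hx => by rw [hav x hx])
    rw [e1, ← Finset.sum_image (s := S) (g := castZ d (2*R+1))
      (f := fun g => av (WW d (n (k (liftZ d (2*R+1) g)))) (sN d (2 * R + 1))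
        (fun g => f (liftZ d _ g)) g ^ p) hinj]
    refine Finset.sum_le_sum_of_subset_of_nonneg (Finset.subset_univ _) fun g _ _ => ?_
    refine Real.rpow_nonneg ?_ _
    exact mul_nonneg (by positivity) (Finset.sum_nonneg fun w _ => hf _)
  calc ∑ x ∈ S, ENNReal.ofReal (avZ d (n (k x)) f x) ^ p
      = ENNReal.ofReal (∑ x ∈ S, avZ d (n (k x)) f x ^ p) := by
        rw [ENNReal.ofReal_sum_of_nonneg fun x _ => Real.rpow_nonneg (avZ_nonneg hf x) _]
        exact Finset.sum_congr rfl fun x _ => ENNReal.ofReal_rpow_of_nonneg (avZ_nonneg hf x) p0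
    _ ≤ ENNReal.ofReal (B * ∑ g, f (liftZ d (2 * R + 1) g) ^ p) := ENNReal.ofReal_le_ofReal step1
    _ = ENNReal.ofReal B * ∑' g, ENNReal.ofReal (f (liftZ d (2 * R + 1) g)) ^ p := by
        rw [ENNReal.ofReal_mul hB0, ENNReal.ofReal_sum_of_nonneg fun x _ => Real.rpow_nonneg (hf _) _,
          tsum_fintype]
        congr 1
        exact Finset.sum_congr rfl fun x _ => (ENNReal.ofReal_rpow_of_nonneg (hf _) p0).symm
    _ ≤ _ := by
        gcongr
        exact ENNReal.tsum_comp_le_tsum_of_injective (liftZ_inj d _)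
          (fun x => ENNReal.ofReal (f x) ^ p)

lemma rpow_iSup_le {p : ℝ} (hp : 0 < p) {ι : Sort*} (u : ι → ENNReal) (c : ENNReal)
    (h : ∀ i, u i ^ p ≤ c) : (⨆ i, u i) ^ p ≤ c := by
  rw [← ENNReal.le_rpow_inv_iff hp]
  exact iSup_le fun i => (ENNReal.le_rpow_inv_iff hp).2 (h i)

lemma transfer {p B : ℝ} (hp : 1 < p) (hB0 : 0 ≤ B)
    (hB : ∀ (G : Type) [AddCommGroup G] [Fintype G] (V : Type) [Fintype V]
      [Nonempty V] (ι : Type) (v : ℕ → V → G) (J : ℕ) (W : ℕ → Finset ι) (s : ι → G),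
      (∀ j, (W j).Nonempty) → SymHyp v J W s → MaxB J W s p B)
    (d : ℕ) (n : ℕ → ℕ) (hn : ScaleC n) (f : (Fin d → ℤ) → ℝ) (hf : ∀ x, 0 ≤ f x) :
    ∑' x, ⨆ j, ENNReal.ofReal (avZ d (n (j + 1)) f x) ^ p
      ≤ ENNReal.ofReal B * ∑' x, ENNReal.ofReal (f x) ^ p := by
  rw [ENNReal.tsum_eq_iSup_sum]
  refine iSup_le fun S => ?_
  have e : ∀ x, ⨆ j, ENNReal.ofReal (avZ d (n (j + 1)) f x) ^ p
      = ⨆ J : ℕ, (Finset.range (J + 1)).sup fun j => ENNReal.ofReal (avZ d (n (j + 1)) f x) ^ p := by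
    intro x
    apply le_antisymm
    · refine iSup_le fun j => le_iSup_of_le j ?_
      exact Finset.le_sup (f := fun j => ENNReal.ofReal (avZ d (n (j + 1)) f x) ^ p) (Finset.self_mem_range_succ j)
    · refine iSup_le fun J => Finset.sup_le fun j _ => ?_
      exact le_iSup (fun j => ENNReal.ofReal (avZ d (n (j + 1)) f x) ^ p) j
  simp only [e]
  rw [ENNReal.finsetSum_iSup_of_monotone]
  swap
  · intro x J J' hJ
    exact Finset.sup_mono (Finset.range_mono (by omega))
  refine iSup_le fun J => ?_
  have : ∀ x, ∃ j ∈ Finset.range (J + 1), ((Finset.range (J + 1)).sup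
      fun j => ENNReal.ofReal (avZ d (n (j + 1)) f x) ^ p) = ENNReal.ofReal (avZ d (n (j + 1)) f x) ^ p :=
    fun x => Finset.exists_mem_eq_sup _ ⟨0, by simp⟩ _
  choose k hk1 hk2 using this
  simp only [hk2]
  refine transfer_fin hp hB0 hB d n hn f hf (J + 1) S (fun x => k x + 1) fun x => ?_
  have := Finset.mem_range.1 (hk1 x)
  omega

lemma exists_scale (b : ℕ → ℝ) (hb : ∀ i i', i < i' → 6 * b i ≤ b i') :
    ∃ n : ℕ → ℕ, ScaleC n ∧ ∀ i, 1 ≤ b i → ∃ j, n (j + 1) = ⌊b i⌋₊ := by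
  classical
  set Lg : ℕ → ℕ := fun i => Nat.log 2 (2 * ⌊b i⌋₊ + 1) with hLg
  have mono : ∀ i i', i < i' → 1 ≤ b i → Lg i < Lg i' := by
    intro i i' h h1
    have h2 := hb i i' h
    have h3 : (⌊b i⌋₊ : ℝ) ≤ b i := Nat.floor_le (by linarith)
    have h4 : b i' < ⌊b i'⌋₊ + 1 := Nat.lt_floor_add_one _
    have h5 : (2 * ⌊b i⌋₊ + 1) * 2 ≤ 2 * ⌊b i'⌋₊ + 1 := by
      have : (((2 * ⌊b i⌋₊ + 1) * 2 : ℕ) : ℝ) ≤ ((2 * ⌊b i'⌋₊ + 1 : ℕ) : ℝ) := by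
        push_cast; linarith
      exact_mod_cast this
    have h6 := Nat.log_mono_right (b := 2) h5
    rw [Nat.log_mul_base (by norm_num) (by omega)] at h6
    simp only [hLg]; omega
  have inj : ∀ i i', 1 ≤ b i → 1 ≤ b i' → Lg i = Lg i' → i = i' := by
    intro i i' h h' e
    rcases lt_trichotomy i i' with hl | hl | hl
    · have := mono _ _ hl h; omega
    · exact hl
    · have := mono _ _ hl h'; omega
  refine ⟨fun j => if h : ∃ i, 1 ≤ b i ∧ Lg i = j then ⌊b h.choose⌋₊ else 2 ^ (j - 1), ?_, ?_⟩
  · intro j hj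
    by_cases h : ∃ i, 1 ≤ b i ∧ Lg i = j
    · simp only [h, dite_true]
      obtain ⟨h1, h2⟩ := h.choose_spec
      set i := h.choose
      constructor
      · conv_lhs => rw [← h2]
        exact Nat.pow_log_le_self 2 (by omega)
      · conv_rhs => rw [← h2]
        exact Nat.lt_pow_succ_log_self (by norm_num) _
    · simp only [h, dite_false]
      obtain ⟨m, rfl⟩ : ∃ m, j = m + 1 := ⟨j - 1, by omega⟩
      have : 0 < 2 ^ m := by positivity
      simp only [Nat.add_sub_cancel, pow_succ]
      omega
  · intro i hi
    have hpos : 1 ≤ Lg i := by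
      have : 1 ≤ ⌊b i⌋₊ := Nat.le_floor (by simpa using hi)
      exact Nat.log_pos (by norm_num) (by omega)
    refine ⟨Lg i - 1, ?_⟩
    have e : Lg i - 1 + 1 = Lg i := by omega
    rw [e]
    have h : ∃ i', 1 ≤ b i' ∧ Lg i' = Lg i := ⟨i, hi, rfl⟩
    simp only [h, dite_true]
    rw [inj _ _ h.choose_spec.1 hi h.choose_spec.2]

lemma cubeAvg_le {d : ℕ} {t : ℝ} (ht : 0 < t) (f : (Fin d → ℤ) → ℂ) (x : Fin d → ℤ) :
    (‖cubeAvg d t f x‖₊ : ℝ≥0∞) ≤ ENNReal.ofReal (avZ d ⌊t⌋₊ (fun y => ‖f y‖) x) := by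
  have e : (⌊t⌋ : ℤ) = (⌊t⌋₊ : ℤ) := (Int.natCast_floor_eq_floor ht.le).symm
  have : ‖cubeAvg d t f x‖ ≤ avZ d ⌊t⌋₊ (fun y => ‖f y‖) x := by
    unfold cubeAvg avZ av
    rw [WW_card, e, norm_mul]
    have e2 : ‖((((2 * (⌊t⌋₊ : ℤ) + 1) ^ d : ℤ) : ℂ))⁻¹‖ = (((2 * ⌊t⌋₊ + 1) ^ d : ℕ) : ℝ)⁻¹ := by
      rw [norm_inv]
      congr 1
      have : ((((2 * (⌊t⌋₊ : ℤ) + 1) ^ d : ℤ) : ℂ)) = (((2 * ⌊t⌋₊ + 1) ^ d : ℕ) : ℂ) := by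
        push_cast; rfl
      rw [this, Complex.norm_natCast]
    rw [e2]
    refine mul_le_mul_of_nonneg_left ?_ (by positivity)
    simp only [← sub_eq_add_neg]
    exact norm_sum_le _ _
  rw [← enorm_eq_nnnorm, ← ofReal_norm]
  exact ENNReal.ofReal_le_ofReal this

lemma avZ_zero {d : ℕ} (g : (Fin d → ℤ) → ℝ) (x : Fin d → ℤ) : avZ d 0 g x = g x := by
  have : WW d 0 = {0} := by
    ext y
    rw [mem_WW, Finset.mem_singleton, funext_iff]
    refine forall_congr' fun l => ?_
    simp only [Pi.zero_apply]
    push_cast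
    omega
  simp [avZ, av, this]

lemma fin_case {p : ℝ} (hp : 1 < p) (A : ℝ) (hA : 1 < A) :
    ∃ C : ℝ, 0 < C ∧ ∀ (d : ℕ) (a : ℕ → ℝ), (∀ n, 0 < a n) →
      (∀ n, A ≤ a (n + 1) / a n) →
      ∀ f : (Fin d → ℤ) → ℂ,
      ∑' x, (⨆ n : ℕ, (‖cubeAvg d (a n) f x‖₊ : ℝ≥0∞)) ^ p
        ≤ ENNReal.ofReal C * ∑' x, nnC f x ^ p := by
  obtain ⟨B, hB0, hB⟩ := bdd_all hp
  obtain ⟨k, hk⟩ := pow_unbounded_of_one_lt 6 hA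
  refine ⟨1 + (k + 1 : ℕ) * B, by positivity, fun d a ha hr f => ?_⟩
  have hstep : ∀ n, A * a n ≤ a (n + 1) := fun n => (le_div_iff₀ (ha n)).1 (hr n)
  have hpow : ∀ n m, A ^ m * a n ≤ a (n + m) := by
    intro n m
    induction m with
    | zero => simp
    | succ m ih =>
      calc A ^ (m + 1) * a n = A * (A ^ m * a n) := by ring
        _ ≤ A * a (n + m) := by gcongr
        _ ≤ a (n + (m + 1)) := hstep _
  have h6 : ∀ r i i', i < i' → 6 * a (r + (k + 1) * i) ≤ a (r + (k + 1) * i') := by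
    intro r i i' h
    obtain ⟨m, hm⟩ : ∃ m, r + (k + 1) * i' = r + (k + 1) * i + (k + m) := by
      obtain ⟨q, rfl⟩ := Nat.exists_eq_add_of_lt h
      exact ⟨1 + (k + 1) * q, by ring⟩
    rw [hm]
    refine le_trans ?_ (hpow _ _)
    have : 6 ≤ A ^ (k + m) := hk.le.trans (pow_le_pow_right₀ hA.le (by omega))
    have := ha (r + (k + 1) * i)
    gcongr
  choose n hn1 hn2 using fun r => exists_scale (fun i => a (r + (k + 1) * i)) (h6 r)
  set g : (Fin d → ℤ) → ℝ := fun y => ‖f y‖ with hg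
  have hg0 : ∀ y, 0 ≤ g y := fun y => norm_nonneg _
  have hgf : ∀ y, ENNReal.ofReal (g y) = nnC f y := fun y => ofReal_norm (f y)
  have p0 : 0 < p := by linarith
  have hpt : ∀ x, (⨆ m : ℕ, (‖cubeAvg d (a m) f x‖₊ : ℝ≥0∞)) ^ p ≤
      ENNReal.ofReal (g x) ^ p +
        ∑ r ∈ Finset.range (k + 1), ⨆ j, ENNReal.ofReal (avZ d (n r (j + 1)) g x) ^ p := by
    intro x
    refine rpow_iSup_le p0 _ _ fun m => ?_
    refine (ENNReal.rpow_le_rpow (cubeAvg_le (ha m) f x) p0.le).trans ?_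
    by_cases h1 : 1 ≤ a m
    · refine le_trans ?_ le_add_self
      have em : m % (k + 1) + (k + 1) * (m / (k + 1)) = m := Nat.mod_add_div m (k + 1)
      obtain ⟨j, hj⟩ := hn2 (m % (k + 1)) (m / (k + 1)) (by simpa only [em] using h1)
      simp only [em] at hj
      rw [← hj]
      refine le_trans (le_iSup (fun j => ENNReal.ofReal (avZ d (n (m % (k + 1)) (j + 1)) g x) ^ p) j) ?_
      exact Finset.single_le_sum
        (f := fun r => ⨆ j, ENNReal.ofReal (avZ d (n r (j + 1)) g x) ^ p)
        (fun _ _ => zero_le) (Finset.mem_range.2 (Nat.mod_lt _ (by omega)))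
    · refine le_trans ?_ le_self_add
      rw [Nat.floor_eq_zero.2 (not_le.1 h1), avZ_zero]
  calc ∑' x, (⨆ m : ℕ, (‖cubeAvg d (a m) f x‖₊ : ℝ≥0∞)) ^ p
      ≤ ∑' x, (ENNReal.ofReal (g x) ^ p +
        ∑ r ∈ Finset.range (k + 1), ⨆ j, ENNReal.ofReal (avZ d (n r (j + 1)) g x) ^ p) :=
        ENNReal.tsum_le_tsum hpt
    _ = ∑' x, ENNReal.ofReal (g x) ^ p + ∑ r ∈ Finset.range (k + 1),
          ∑' x, ⨆ j, ENNReal.ofReal (avZ d (n r (j + 1)) g x) ^ p := by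
        rw [ENNReal.tsum_add, Summable.tsum_finsetSum fun _ _ => ENNReal.summable]
    _ ≤ ∑' x, ENNReal.ofReal (g x) ^ p + ∑ r ∈ Finset.range (k + 1),
          ENNReal.ofReal B * ∑' x, ENNReal.ofReal (g x) ^ p := by
        gcongr with r hr
        exact transfer hp hB0 hB d (n r) (hn1 r) g hg0
    _ = ENNReal.ofReal (1 + (k + 1 : ℕ) * B) * ∑' x, nnC f x ^ p := by
        simp only [hgf]
        rw [Finset.sum_const, Finset.card_range, nsmul_eq_mul, ENNReal.ofReal_add zero_le_one
          (by positivity), ENNReal.ofReal_mul (by positivity), ENNReal.ofReal_natCast,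
          ENNReal.ofReal_one]
        ring

lemma avZ_le_of_le {d n : ℕ} {g : (Fin d → ℤ) → ℝ} {c : ℝ} (h : ∀ y, g y ≤ c) (x : Fin d → ℤ) :
    avZ d n g x ≤ c := by
  unfold avZ av
  have hc : (0:ℝ) < (WW d n).card := by exact_mod_cast (WW_nonempty d n).card_pos
  rw [inv_mul_le_iff₀ hc]
  refine (Finset.sum_le_card_nsmul _ _ c fun w _ => h _).trans ?_
  rw [nsmul_eq_mul]

theorem statement4 (p : ℝ≥0∞) (hp : 1 < p) (A : ℝ) (hA : 1 < A) :
    ∃ C : ℝ, 0 < C ∧ ∀ (d : ℕ) (a : ℕ → ℝ), (∀ n, 0 < a n) →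
      (∀ n, A ≤ a (n + 1) / a n) →
      ∀ f : (Fin d → ℤ) → ℂ, lpZ d p (nnC f) ≠ ∞ →
      lpZ d p (fun x => ⨆ n : ℕ, (‖cubeAvg d (a n) f x‖₊ : ℝ≥0∞))
        ≤ ENNReal.ofReal C * lpZ d p (nnC f) := by
  by_cases hpt : p = ∞
  · refine ⟨1, one_pos, fun d a ha _ f hf => ?_⟩
    simp only [lpZ, hpt, if_true] at hf ⊢
    rw [ENNReal.ofReal_one, one_mul]
    refine iSup_le fun x => iSup_le fun n => (cubeAvg_le (ha n) f x).trans ?_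
    refine ENNReal.ofReal_le_of_le_toReal (avZ_le_of_le (fun y => ?_) x)
    have h1 : nnC f y ≤ ⨆ x, nnC f x := le_iSup _ y
    have h2 := ENNReal.toReal_mono hf h1
    simpa [nnC] using h2
  · have hq : 1 < p.toReal := by
      have := (ENNReal.toReal_lt_toReal ENNReal.one_ne_top hpt).2 hp
      simpa using this
    obtain ⟨C, hC, h⟩ := fin_case hq A hA
    refine ⟨C ^ (1 / p.toReal), by positivity, fun d a ha hr f _ => ?_⟩
    simp only [lpZ, hpt, if_false]
    rw [← ENNReal.ofReal_rpow_of_pos hC, ← ENNReal.mul_rpow_of_nonneg _ _ (by positivity)]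
    exact ENNReal.rpow_le_rpow (h d a ha hr f) (by positivity)
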